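/- arXiv:2301.08298 — 4 statements merged into one kernel-verified Lean document; each statement's English description precedes it below -/
import Mathlib

section
/- C₀^s(S) = min{ (2d)^s / μ(B(x,d)) : x ∈ S₀₁, √3/16 ≤ d ≤ √3/8 }. That is, the infimum of (2d)^s/μ(B(x,d)) over x ∈ S₀₁ and d ∈ [√3/16, √3/8] is attained and equals the centred Hausdorff premeasure of the Sierpinski gasket. -/
open MeasureTheory Metric Set
open scoped ENNReal

noncomputable section

/-- The point `(a, b)` of the Euclidean plane. -/
def pt (a b : ℝ) : EuclideanSpace ℝ (Fin 2) := (WithLp.equiv 2 (Fin 2 → ℝ)).symm ![a, b]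

/-- The translation vectors of the three similitudes. -/
def v : Fin 3 → EuclideanSpace ℝ (Fin 2)
  | 0 => pt 0 0
  | 1 => pt (1/2) 0
  | 2 => pt (1/4) (Real.sqrt 3 / 4)

/-- The three similitudes generating the Sierpinski gasket. -/
def f (i : Fin 3) (x : EuclideanSpace ℝ (Fin 2)) : EuclideanSpace ℝ (Fin 2) :=
  (1/2 : ℝ) • x + v i

/-- `fword [i₁, …, i_k] = f_{i₁} ∘ ⋯ ∘ f_{i_k}`. -/
def fword : List (Fin 3) → EuclideanSpace ℝ (Fin 2) → EuclideanSpace ℝ (Fin 2)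
  | [] => id
  | i :: l => f i ∘ fword l

/-- The similarity dimension `s = log 3 / log 2`. -/
def sDim : ℝ := Real.log 3 / Real.log 2

/-- The normalised Hausdorff measure `μ = H^s(S)⁻¹ • H^s⌊S`. -/
def muS (S : Set (EuclideanSpace ℝ (Fin 2))) : Measure (EuclideanSpace ℝ (Fin 2)) :=
  (μH[sDim] S)⁻¹ • (μH[sDim]).restrict S

/-- Fixed points `z_i = 2 v_i`. -/
def z (i : Fin 3) : EuclideanSpace ℝ (Fin 2) := (2 : ℝ) • v i

/-- The Hutchinson operator. -/
def Fop (A : Set (EuclideanSpace ℝ (Fin 2))) : Set (EuclideanSpace ℝ (Fin 2)) :=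
  f 0 '' A ∪ f 1 '' A ∪ f 2 '' A

/-- The discrete approximations `A_k = F^{k-1}(A₁)`, `A₁ = {z₀, z₁, z₂}`. -/
def Aset (k : ℕ) : Set (EuclideanSpace ℝ (Fin 2)) := Fop^[k - 1] {z 0, z 1, z 2}

/-- The discrete measures `μ_k`. -/
def muk (k : ℕ) : Measure (EuclideanSpace ℝ (Fin 2)) :=
  ((3 : ℝ≥0∞)⁻¹ ^ k) • ∑ i : Fin (k - 1) → Fin 3,
    (Measure.dirac (fword (List.ofFn i) (z 0)) + Measure.dirac (fword (List.ofFn i) (z 1)) +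
      Measure.dirac (fword (List.ofFn i) (z 2)))

/-- The centred Hausdorff premeasure `C₀^s(A)` (the limit as `δ → 0⁺` is written as a
supremum over `δ > 0`, the inner infimum being antitone in `δ`). -/
def centredPremeasure (s : ℝ) (A : Set (EuclideanSpace ℝ (Fin 2))) : ℝ≥0∞ :=
  ⨆ (δ : ℝ) (_ : 0 < δ),
    ⨅ (x : ℕ → EuclideanSpace ℝ (Fin 2)) (d : ℕ → ℝ) (_ : ∀ n, x n ∈ A)
      (_ : ∀ n, 0 ≤ d n) (_ : ∀ n, 2 * d n ≤ δ) (_ : A ⊆ ⋃ n, closedBall (x n) (d n)),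
      ∑' n, ENNReal.ofReal ((2 * d n) ^ s)

/-- The reflection across the vertical line `x₁ = 1/2`. -/
def refl2 (x : EuclideanSpace ℝ (Fin 2)) : EuclideanSpace ℝ (Fin 2) := pt (1 - x 0) (x 1)

/-- The reflection across the vertical line `x₁ = 1/4`. -/
def refl4 (x : EuclideanSpace ℝ (Fin 2)) : EuclideanSpace ℝ (Fin 2) := pt (1/2 - x 0) (x 1)

local notation "Plane" => EuclideanSpace ℝ (Fin 2)

/-! ### Barycentric coordinates with respect to the fixed points `z i` -/

lemma f_apply (i : Fin 3) (x : Plane) (k : Fin 2) : f i x k = x k / 2 + v i k := by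
  simp [f]; ring

/-- The barycentric coordinates of a point with respect to the triangle `z 0, z 1, z 2`. -/
def bary (x : Plane) (k : Fin 3) : ℝ :=
  ![1 - x 0 - x 1 / √3, x 0 - x 1 / √3, 2 * x 1 / √3] k

lemma bary_sum (x : Plane) : ∑ k, bary x k = 1 := by
  simp [bary, Fin.sum_univ_three]; ring

/-- The point with given barycentric coordinates. -/
def ofBary (a : Fin 3 → ℝ) : Plane := pt (a 1 + a 2 / 2) (√3 / 2 * a 2)

lemma ofBary_bary (x : Plane) : ofBary (bary x) = x := by
  ext k
  fin_cases k
  · simp [ofBary, bary, pt]; ring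
  · simp [ofBary, bary, pt]

lemma bary_ofBary {a : Fin 3 → ℝ} (ha : ∑ k, a k = 1) : bary (ofBary a) = a := by
  have h3 : √3 ≠ 0 := by positivity
  rw [Fin.sum_univ_three] at ha
  ext k
  fin_cases k
  · simp [ofBary, bary, pt]; field_simp; linarith
  · simp [ofBary, bary, pt]; field_simp; ring
  · simp [ofBary, bary, pt]; field_simp

lemma bary_injective : Function.Injective bary :=
  Function.LeftInverse.injective ofBary_bary

lemma continuous_bary (k : Fin 3) : Continuous fun x ↦ bary x k := by
  fin_cases k <;> simp only [bary] <;> simp <;> fun_prop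

lemma bary_f (i : Fin 3) (x : Plane) (k : Fin 3) :
    bary (f i x) k = bary x k / 2 + if k = i then 1 / 2 else 0 := by
  have h3 : √3 ≠ 0 := by positivity
  fin_cases i <;> fin_cases k <;> simp [bary, f_apply, v, pt] <;> field_simp <;> ring

lemma dist_sq_eq_bary (x y : Plane) :
    dist x y ^ 2 = (∑ k, (bary x k - bary y k) ^ 2) / 2 := by
  have h3 : √3 ≠ 0 := by positivity
  have h3' : √3 ^ 2 = 3 := Real.sq_sqrt (by norm_num)
  rw [EuclideanSpace.dist_eq, Real.sq_sqrt (by positivity)]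
  simp [Fin.sum_univ_three, bary, Real.dist_eq]
  field_simp
  rw [h3']
  linear_combination -2 * (x 0 - y 0) ^ 2 * h3'

lemma abs_bary_sub_le (x y : Plane) (k : Fin 3) :
    |bary x k - bary y k| ≤ 2 / √3 * dist x y := by
  have h3' : √3 ^ 2 = 3 := Real.sq_sqrt (by norm_num)
  apply abs_le_of_sq_le_sq _ (by positivity)
  rw [mul_pow, div_pow, h3', dist_sq_eq_bary]
  have hx := bary_sum x
  have hy := bary_sum y
  rw [Fin.sum_univ_three] at *
  fin_cases k <;> simp only [Fin.zero_eta, Fin.mk_one, Fin.reduceFinMk]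
  · have : bary x 0 - bary y 0 = -(bary x 1 - bary y 1) - (bary x 2 - bary y 2) := by linarith
    rw [this]
    nlinarith [sq_nonneg ((bary x 1 - bary y 1) - (bary x 2 - bary y 2))]
  · have : bary x 1 - bary y 1 = -(bary x 0 - bary y 0) - (bary x 2 - bary y 2) := by linarith
    rw [this]
    nlinarith [sq_nonneg ((bary x 0 - bary y 0) - (bary x 2 - bary y 2))]
  · have : bary x 2 - bary y 2 = -(bary x 0 - bary y 0) - (bary x 1 - bary y 1) := by linarith
    rw [this]
    nlinarith [sq_nonneg ((bary x 0 - bary y 0) - (bary x 1 - bary y 1))]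

/-- The symmetry of the triangle that permutes its vertices according to `σ`. -/
def triSymm (σ : Equiv.Perm (Fin 3)) (x : Plane) : Plane := ofBary (bary x ∘ σ.symm)

lemma bary_triSymm (σ : Equiv.Perm (Fin 3)) (x : Plane) (k : Fin 3) :
    bary (triSymm σ x) k = bary x (σ.symm k) := by
  rw [triSymm, bary_ofBary]
  · rfl
  · rw [← bary_sum x]
    exact Equiv.sum_comp σ.symm (bary x)

lemma dist_triSymm (σ : Equiv.Perm (Fin 3)) (x y : Plane) :
    dist (triSymm σ x) (triSymm σ y) = dist x y := by
  rw [← sq_eq_sq₀ dist_nonneg dist_nonneg, dist_sq_eq_bary, dist_sq_eq_bary]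
  simp only [bary_triSymm]
  rw [Equiv.sum_comp σ.symm fun k ↦ (bary x k - bary y k) ^ 2]

lemma triSymm_f (σ : Equiv.Perm (Fin 3)) (i : Fin 3) (x : Plane) :
    triSymm σ (f i x) = f (σ i) (triSymm σ x) := by
  apply bary_injective
  ext k
  simp only [bary_triSymm, bary_f, Equiv.symm_apply_eq]

lemma dist_f (i : Fin 3) (x y : Plane) : dist (f i x) (f i y) = dist x y / 2 := by
  rw [f, f, dist_add_right, dist_smul₀]
  simp; ring

lemma continuous_f (i : Fin 3) : Continuous (f i) := by
  unfold f; fun_prop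

/-! ### Geometry of the gasket -/

/-- The invariance property characterising the Sierpinski gasket among nonempty compact sets. -/
structure IsGasket (S : Set Plane) : Prop where
  isCompact : IsCompact S
  nonempty : S.Nonempty
  eq_union : S = f 0 '' S ∪ f 1 '' S ∪ f 2 '' S

namespace IsGasket

variable {S T : Set Plane}

lemma f_mem (hS : IsGasket S) (i : Fin 3) {x : Plane} (hx : x ∈ S) : f i x ∈ S := by
  rw [hS.eq_union]
  fin_cases i
  · exact .inl (.inl (mem_image_of_mem _ hx))
  · exact .inl (.inr (mem_image_of_mem _ hx))
  · exact .inr (mem_image_of_mem _ hx)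

lemma exists_eq_f (hS : IsGasket S) {x : Plane} (hx : x ∈ S) : ∃ i, ∃ y ∈ S, x = f i y := by
  rw [hS.eq_union] at hx
  rcases hx with (⟨y, hy, rfl⟩ | ⟨y, hy, rfl⟩) | ⟨y, hy, rfl⟩
  exacts [⟨_, y, hy, rfl⟩, ⟨_, y, hy, rfl⟩, ⟨_, y, hy, rfl⟩]

lemma subset (hS : IsGasket S) (hT : IsGasket T) : S ⊆ T := by
  obtain ⟨t, ht⟩ := hT.nonempty
  obtain ⟨R, hR⟩ := hS.isCompact.isBounded.subset_closedBall t
  have key (n : ℕ) : ∀ x ∈ S, ∃ y ∈ T, dist x y ≤ R * (1 / 2) ^ n := by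
    induction n with
    | zero => exact fun x hx ↦ ⟨t, ht, by simpa using hR hx⟩
    | succ n ih =>
      intro x hx
      obtain ⟨i, x', hx', rfl⟩ := hS.exists_eq_f hx
      obtain ⟨y, hy, hxy⟩ := ih x' hx'
      refine ⟨f i y, hT.f_mem i hy, ?_⟩
      rw [dist_f, pow_succ]
      linarith
  intro x hx
  rw [← hT.isCompact.isClosed.closure_eq, Metric.mem_closure_iff]
  intro ε hε
  have hlim : Filter.Tendsto (fun n : ℕ ↦ R * (1 / 2) ^ n) Filter.atTop (nhds (R * 0)) :=
    (tendsto_pow_atTop_nhds_zero_of_lt_one (by norm_num) (by norm_num)).const_mul R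
  rw [mul_zero] at hlim
  obtain ⟨n, hn⟩ := (hlim.eventually_lt_const hε).exists
  obtain ⟨y, hy, hxy⟩ := key n x hx
  exact ⟨y, hy, hxy.trans_lt hn⟩

lemma image_triSymm (hS : IsGasket S) (σ : Equiv.Perm (Fin 3)) : IsGasket (triSymm σ '' S) where
  isCompact := hS.isCompact.image
    (LipschitzWith.of_dist_le_mul (K := 1) fun x y ↦ by simp [dist_triSymm]).continuous
  nonempty := hS.nonempty.image _
  eq_union := by
    ext x
    constructor
    · rintro ⟨y, hy, rfl⟩
      obtain ⟨i, w, hw, rfl⟩ := hS.exists_eq_f hy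
      rw [triSymm_f]
      generalize σ i = j
      fin_cases j
      · exact .inl (.inl ⟨_, ⟨w, hw, rfl⟩, rfl⟩)
      · exact .inl (.inr ⟨_, ⟨w, hw, rfl⟩, rfl⟩)
      · exact .inr ⟨_, ⟨w, hw, rfl⟩, rfl⟩
    · have (j : Fin 3) : f j '' (triSymm σ '' S) ⊆ triSymm σ '' S := by
        rintro _ ⟨_, ⟨y, hy, rfl⟩, rfl⟩
        refine ⟨f (σ.symm j) y, hS.f_mem _ hy, ?_⟩
        rw [triSymm_f, Equiv.apply_symm_apply]
      rintro ((h | h) | h)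
      exacts [this _ h, this _ h, this _ h]

lemma triSymm_mem (hS : IsGasket S) (σ : Equiv.Perm (Fin 3)) {x : Plane} (hx : x ∈ S) :
    triSymm σ x ∈ S :=
  (hS.image_triSymm σ).subset hS (mem_image_of_mem _ hx)

lemma bary_nonneg (hS : IsGasket S) {x : Plane} (hx : x ∈ S) (k : Fin 3) : 0 ≤ bary x k := by
  obtain ⟨y, hy, hmin⟩ := hS.isCompact.exists_isMinOn hS.nonempty (continuous_bary k).continuousOn
  have hyx : bary y k ≤ bary x k := hmin hx
  obtain ⟨i, w, hw, rfl⟩ := hS.exists_eq_f hy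
  have hyw : bary (f i w) k ≤ bary w k := hmin hw
  rw [bary_f] at *
  split_ifs at * <;> linarith

lemma half_le_bary_f (hS : IsGasket S) (i : Fin 3) {x : Plane} (hx : x ∈ S) :
    1 / 2 ≤ bary (f i x) i := by
  have := hS.bary_nonneg hx i
  rw [bary_f, if_pos rfl]
  linarith

/-- A point of the gasket whose `i`-th barycentric coordinate exceeds `1 / 2` lies in the cell
`f i S`. -/
lemma eq_f_of_half_lt (hS : IsGasket S) {i : Fin 3} {x : Plane} (hx : x ∈ S)
    (h : 1 / 2 < bary x i) : ∃ y ∈ S, x = f i y := by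
  obtain ⟨j, y, hy, rfl⟩ := hS.exists_eq_f hx
  by_cases hij : i = j
  · exact ⟨y, hy, hij ▸ rfl⟩
  · have h0 (k) := hS.bary_nonneg hy k
    have hle : bary y i ≤ ∑ k, bary y k :=
      Finset.single_le_sum (fun k _ ↦ h0 k) (Finset.mem_univ i)
    rw [bary_sum] at hle
    rw [bary_f, if_neg hij] at h
    linarith

/-- A point of the cell `f i S` whose `j`-th barycentric coordinate exceeds `1 / 4` lies in the
subcell `f i (f j S)`. -/
lemma eq_f_f_of_quarter_lt (hS : IsGasket S) {i j : Fin 3} (hij : i ≠ j) {x : Plane}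
    (hx : x ∈ S) (h : 1 / 4 < bary (f i x) j) : ∃ y ∈ S, x = f j y := by
  apply hS.eq_f_of_half_lt hx
  rw [bary_f, if_neg hij.symm] at h
  linarith

end IsGasket

/-! ### Scaling of the measure -/

lemma sDim_pos : 0 < sDim := div_pos (Real.log_pos (by norm_num)) (Real.log_pos (by norm_num))

lemma two_rpow_sDim : (2 : ℝ) ^ sDim = 3 := by
  rw [sDim, Real.log_div_log]
  exact Real.rpow_logb (by norm_num) (by norm_num) (by norm_num)

lemma ennreal_half_rpow_sDim : (((1 / 2 : NNReal) : NNReal) : ℝ≥0∞) ^ sDim = 3⁻¹ := by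
  rw [← ENNReal.coe_rpow_of_nonneg _ sDim_pos.le]
  have : (1 / 2 : NNReal) ^ sDim = 3⁻¹ := by
    apply NNReal.eq
    push_cast
    rw [one_div, Real.inv_rpow (by norm_num), two_rpow_sDim]
  rw [this]
  norm_num

lemma ennreal_two_rpow_sDim : ((2 : NNReal) : ℝ≥0∞) ^ sDim = 3 := by
  rw [← ENNReal.coe_rpow_of_nonneg _ sDim_pos.le]
  have : (2 : NNReal) ^ sDim = 3 := by
    apply NNReal.eq
    push_cast
    exact two_rpow_sDim
  rw [this]
  norm_num

lemma ofReal_half_rpow_sDim {t : ℝ} (ht : 0 ≤ t) :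
    ENNReal.ofReal ((t / 2) ^ sDim) = 3⁻¹ * ENNReal.ofReal (t ^ sDim) := by
  rw [Real.div_rpow ht (by norm_num), two_rpow_sDim, div_eq_inv_mul,
    ENNReal.ofReal_mul (by norm_num), ENNReal.ofReal_inv_of_pos (by norm_num)]
  norm_num

section Measure

variable {S : Set Plane}

lemma muS_apply (S : Set Plane) {A : Set Plane} (hA : MeasurableSet A) :
    muS S A = (μH[sDim] S)⁻¹ * μH[sDim] (A ∩ S) := by
  simp [muS, Measure.restrict_apply hA]

lemma muS_le_of_antilipschitz {g : Plane → Plane} {K : NNReal} (hg : AntilipschitzWith K g)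
    {A B : Set Plane} (hA : MeasurableSet A) (hB : MeasurableSet B)
    (h : MapsTo g (A ∩ S) (B ∩ S)) :
    muS S A ≤ (K : ℝ≥0∞) ^ sDim * muS S B := by
  rw [muS_apply S hA, muS_apply S hB, mul_left_comm]
  gcongr
  calc μH[sDim] (A ∩ S) ≤ (K : ℝ≥0∞) ^ sDim * μH[sDim] (g '' (A ∩ S)) :=
        hg.le_hausdorffMeasure_image sDim_pos.le _
    _ ≤ _ := by gcongr; exact h.image_subset

namespace IsGasket

lemma muS_le_sum_preimage (hS : IsGasket S) {A : Set Plane} (hA : MeasurableSet A) :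
    muS S A ≤ 3⁻¹ * (muS S (f 0 ⁻¹' A) + muS S (f 1 ⁻¹' A) + muS S (f 2 ⁻¹' A)) := by
  have himage (i : Fin 3) :
      μH[sDim] (f i '' (f i ⁻¹' A ∩ S)) ≤ 3⁻¹ * μH[sDim] (f i ⁻¹' A ∩ S) := by
    rw [← ennreal_half_rpow_sDim]
    refine LipschitzWith.hausdorffMeasure_image_le (LipschitzWith.of_dist_le_mul fun x y ↦ ?_)
      sDim_pos.le _
    rw [dist_f]
    push_cast
    linarith
  have hcover : A ∩ S ⊆ f 0 '' (f 0 ⁻¹' A ∩ S) ∪ f 1 '' (f 1 ⁻¹' A ∩ S)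
      ∪ f 2 '' (f 2 ⁻¹' A ∩ S) := by
    rintro x ⟨hxA, hxS⟩
    rw [hS.eq_union] at hxS
    rcases hxS with (⟨y, hy, rfl⟩ | ⟨y, hy, rfl⟩) | ⟨y, hy, rfl⟩
    exacts [.inl (.inl ⟨y, ⟨hxA, hy⟩, rfl⟩), .inl (.inr ⟨y, ⟨hxA, hy⟩, rfl⟩),
      .inr ⟨y, ⟨hxA, hy⟩, rfl⟩]
  have hm (i : Fin 3) : MeasurableSet (f i ⁻¹' A) := (continuous_f i).measurable hA
  rw [muS_apply S hA, muS_apply S (hm 0), muS_apply S (hm 1), muS_apply S (hm 2), ← mul_add,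
    ← mul_add, mul_left_comm]
  gcongr
  calc μH[sDim] (A ∩ S) ≤ _ := measure_mono hcover
    _ ≤ _ := (measure_union_le _ _).trans (add_le_add_left (measure_union_le _ _) _)
    _ ≤ _ := by
      rw [mul_add, mul_add]
      gcongr <;> apply himage

end IsGasket

/-- The homothety of ratio `2` centred at the junction point of the cells `i` and `j`. -/
def junctionZoom (i j : Fin 3) (y : Plane) : Plane := (2 : ℝ) • y - (v i + v j)

lemma junctionZoom_f_f (i j : Fin 3) (x : Plane) : junctionZoom i j (f i (f j x)) = f i x := by
  simp only [junctionZoom, f]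
  module

lemma junctionZoom_comm (i j : Fin 3) : junctionZoom i j = junctionZoom j i := by
  ext1 x
  rw [junctionZoom, add_comm, junctionZoom]

lemma junctionZoom_self_f (i : Fin 3) (x : Plane) : junctionZoom i i (f i x) = x := by
  simp only [junctionZoom, f]
  module

lemma dist_junctionZoom (i j : Fin 3) (x y : Plane) :
    dist (junctionZoom i j x) (junctionZoom i j y) = 2 * dist x y := by
  rw [junctionZoom, junctionZoom, dist_sub_right, dist_smul₀]
  simp

/-- Magnifying a ball by the factor `2` when its trace on the gasket is mapped into the gasket. -/
lemma muS_closedBall_le_junctionZoom (i j : Fin 3) {x : Plane} {d : ℝ}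
    (h : ∀ y ∈ S, dist y x ≤ d → junctionZoom i j y ∈ S) :
    muS S (closedBall x d) ≤ 3⁻¹ * muS S (closedBall (junctionZoom i j x) (2 * d)) := by
  rw [← ennreal_half_rpow_sDim]
  refine muS_le_of_antilipschitz (g := junctionZoom i j)
    (AntilipschitzWith.of_le_mul_dist fun x y ↦ ?_)
    measurableSet_closedBall measurableSet_closedBall ?_
  · rw [dist_junctionZoom]
    push_cast
    linarith
  · rintro y ⟨hy, hyS⟩
    rw [mem_closedBall] at hy
    refine ⟨?_, h y hyS hy⟩
    rw [mem_closedBall, dist_junctionZoom]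
    linarith

namespace IsGasket

lemma muS_closedBall_le_f (hS : IsGasket S) (i : Fin 3) (x : Plane) (d : ℝ) :
    muS S (closedBall x (2 * d)) ≤ 3 * muS S (closedBall (f i x) d) := by
  rw [← ennreal_two_rpow_sDim]
  refine muS_le_of_antilipschitz (g := f i) (AntilipschitzWith.of_le_mul_dist fun x y ↦ ?_)
    measurableSet_closedBall measurableSet_closedBall ?_
  · rw [dist_f]
    push_cast
    linarith
  · rintro y ⟨hy, hyS⟩
    rw [mem_closedBall] at hy
    refine ⟨?_, hS.f_mem i hyS⟩
    rw [mem_closedBall, dist_f]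
    linarith

lemma muS_closedBall_le_triSymm (hS : IsGasket S) (σ : Equiv.Perm (Fin 3)) (x : Plane) (d : ℝ) :
    muS S (closedBall x d) ≤ muS S (closedBall (triSymm σ x) d) := by
  have := muS_le_of_antilipschitz (S := S) (K := 1) (g := triSymm σ)
    (AntilipschitzWith.of_le_mul_dist fun x y ↦ by simp [dist_triSymm])
    (measurableSet_closedBall (x := x) (ε := d))
    (measurableSet_closedBall (x := triSymm σ x) (ε := d))
    (fun y ⟨hy, hyS⟩ ↦ ⟨by simpa [dist_triSymm] using hy, hS.triSymm_mem σ hyS⟩)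
  simpa using this

end IsGasket

end Measure

/-! ### Reduction of small balls to balls centred in the cell `01` -/

lemma two_div_sqrt_three_mul_sqrt_three_div (c : ℝ) : 2 / √3 * (√3 / c) = 2 / c := by
  have h3 : √3 ≠ 0 := by positivity
  field_simp

namespace IsGasket

variable {S : Set Plane}

/-- Near a corner cell `f i (f i S)` the gasket coincides with the cell `f i S`. -/
lemma junctionZoom_self_mem (hS : IsGasket S) {i : Fin 3} {x y : Plane} (hx : x ∈ S) (hy : y ∈ S)
    (hxy : dist y (f i (f i x)) < √3 / 8) : junctionZoom i i y ∈ S := by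
  have h1 := hS.bary_nonneg hx i
  have h2 := abs_le.1 (abs_bary_sub_le y (f i (f i x)) i)
  have h3 := mul_lt_mul_of_pos_left hxy (show 0 < 2 / √3 by positivity)
  rw [two_div_sqrt_three_mul_sqrt_three_div] at h3
  simp only [bary_f, if_true] at h2
  obtain ⟨w, hw, rfl⟩ := hS.eq_f_of_half_lt (i := i) hy (by linarith)
  rwa [junctionZoom_self_f]

/-- A ball of radius less than `√3 / 16` centred in `f i S` either only meets `f i S`, or is
centred in a cell `f i (f j S)` and only meets that cell and its neighbour `f j (f i S)`. -/
lemma exists_junctionZoom_mem (hS : IsGasket S) (i : Fin 3) {x : Plane} (hx : x ∈ S) {d : ℝ}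
    (hd : d < √3 / 16) :
    ∃ j, junctionZoom i j (f i x) ∈ S ∧
      ∀ y ∈ S, dist y (f i x) ≤ d → junctionZoom i j y ∈ S := by
  by_cases hsub : ∀ y ∈ S, dist y (f i x) ≤ d → ∃ w ∈ S, y = f i w
  · refine ⟨i, by rwa [junctionZoom_self_f], fun y hy hyd ↦ ?_⟩
    obtain ⟨w, hw, rfl⟩ := hsub y hy hyd
    rwa [junctionZoom_self_f]
  push Not at hsub
  obtain ⟨y, hy, hyd, hyi⟩ := hsub
  obtain ⟨j, y, hyS, rfl⟩ := hS.exists_eq_f hy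
  have hij : i ≠ j := by
    rintro rfl
    exact hyi y hyS rfl
  have hclose (w : Plane) (hw : dist w (f i x) ≤ d) (k : Fin 3) :
      |bary w k - bary (f i x) k| < 1 / 8 := by
    have := mul_lt_mul_of_pos_left (hw.trans_lt hd) (show 0 < 2 / √3 by positivity)
    rw [two_div_sqrt_three_mul_sqrt_three_div] at this
    linarith [abs_bary_sub_le w (f i x) k]
  have hxj : 3 / 8 < bary (f i x) j := by
    linarith [(abs_lt.1 (hclose _ hyd j)).2, hS.half_le_bary_f j hyS]
  have hxi := hS.half_le_bary_f i hx
  have hzoom : ∀ y ∈ S, dist y (f i x) ≤ d → junctionZoom i j y ∈ S := by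
    intro w hw hwd
    have hwi := (abs_lt.1 (hclose w hwd i)).1
    have hwj := (abs_lt.1 (hclose w hwd j)).1
    obtain ⟨k, w, hwS, rfl⟩ := hS.exists_eq_f hw
    by_cases hki : k = i
    · subst hki
      obtain ⟨u, hu, rfl⟩ := hS.eq_f_f_of_quarter_lt hij hwS (by linarith)
      rw [junctionZoom_f_f]
      exact hS.f_mem _ hu
    by_cases hkj : k = j
    · subst hkj
      obtain ⟨u, hu, rfl⟩ := hS.eq_f_f_of_quarter_lt hij.symm hwS (by linarith)
      rw [junctionZoom_comm, junctionZoom_f_f]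
      exact hS.f_mem _ hu
    have hk := hS.half_le_bary_f k hwS
    have hsum : bary (f k w) i + bary (f k w) j + bary (f k w) k ≤ ∑ l, bary (f k w) l := by
      rw [← Finset.sum_pair hij, add_comm, ← Finset.sum_insert (by simp [hki, hkj])]
      exact Finset.sum_le_univ_sum_of_nonneg (hS.bary_nonneg hw)
    rw [bary_sum] at hsum
    linarith
  exact ⟨j, hzoom _ (hS.f_mem i hx) (by simpa using dist_nonneg.trans hyd), hzoom⟩

/-- The bound `m * μ ≤ (2 d) ^ s` passes from a ball to one of half the radius and at most a third
of the mass. -/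
lemma mul_muS_le_of_le_third {m a b : ℝ≥0∞} {d : ℝ} (hd : 0 ≤ d) (hab : a ≤ 3⁻¹ * b)
    (hb : m * b ≤ ENNReal.ofReal ((2 * (2 * d)) ^ sDim)) :
    m * a ≤ ENNReal.ofReal ((2 * d) ^ sDim) := by
  have h2 : 2 * d = 2 * (2 * d) / 2 := by ring
  rw [h2, ofReal_half_rpow_sDim (by positivity)]
  calc m * a ≤ m * (3⁻¹ * b) := by gcongr
    _ = 3⁻¹ * (m * b) := by ring
    _ ≤ _ := by gcongr

lemma mul_muS_closedBall_le_of_base (hS : IsGasket S) {m : ℝ≥0∞}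
    (hm : ∀ x ∈ S, ∀ d ∈ Icc (√3 / 16) (√3 / 8),
      m * muS S (closedBall (f 0 (f 1 x)) d) ≤ ENNReal.ofReal ((2 * d) ^ sDim))
    {x : Plane} (hx : x ∈ S) {d : ℝ} (hd : √3 / 16 ≤ d) (hd' : d < √3 / 8) :
    m * muS S (closedBall x d) ≤ ENNReal.ofReal ((2 * d) ^ sDim) := by
  have hoff (i j : Fin 3) (hij : i ≠ j) {x : Plane} (hx : x ∈ S) :
      m * muS S (closedBall (f i (f j x)) d) ≤ ENNReal.ofReal ((2 * d) ^ sDim) := by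
    obtain ⟨σ, hσi, hσj⟩ : ∃ σ : Equiv.Perm (Fin 3), σ i = 0 ∧ σ j = 1 := by
      revert i j; decide
    refine le_trans ?_ (hm _ (hS.triSymm_mem σ hx) d ⟨hd, hd'.le⟩)
    rw [← hσi, ← hσj, ← triSymm_f, ← triSymm_f]
    exact mul_le_mul' le_rfl (hS.muS_closedBall_le_triSymm σ _ d)
  obtain ⟨i, y, hy, rfl⟩ := hS.exists_eq_f hx
  obtain ⟨j, w, hw, rfl⟩ := hS.exists_eq_f hy
  by_cases hij : i = j
  · subst hij
    obtain ⟨j, hij⟩ := exists_ne i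
    have hzoom := muS_closedBall_le_junctionZoom i i (x := f i (f i w)) (d := d)
      fun y hy hyd ↦ hS.junctionZoom_self_mem hw hy (hyd.trans_lt hd')
    rw [junctionZoom_self_f] at hzoom
    refine le_trans ?_ (hoff i j hij.symm (hS.triSymm_mem (Equiv.swap i j) hw))
    refine mul_le_mul' le_rfl ?_
    calc _ ≤ _ := hzoom
      _ ≤ 3⁻¹ * muS S (closedBall (triSymm (Equiv.swap i j) (f i w)) (2 * d)) := by
        exact mul_le_mul' le_rfl (hS.muS_closedBall_le_triSymm _ _ _)
      _ ≤ 3⁻¹ * (3 * muS S (closedBall (f i (triSymm (Equiv.swap i j) (f i w))) d)) := by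
        exact mul_le_mul' le_rfl (hS.muS_closedBall_le_f _ _ _)
      _ = _ := by
        rw [← mul_assoc, ENNReal.inv_mul_cancel (by norm_num) (by norm_num), one_mul, triSymm_f,
          Equiv.swap_apply_left]
  · exact hoff i j hij hw

lemma mul_muS_closedBall_le (hS : IsGasket S) {m : ℝ≥0∞}
    (hm : ∀ x ∈ S, ∀ d ∈ Icc (√3 / 16) (√3 / 8),
      m * muS S (closedBall (f 0 (f 1 x)) d) ≤ ENNReal.ofReal ((2 * d) ^ sDim))
    {x : Plane} (hx : x ∈ S) {d : ℝ} (hd : 0 < d) (hd' : d < √3 / 8) :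
    m * muS S (closedBall x d) ≤ ENNReal.ofReal ((2 * d) ^ sDim) := by
  obtain ⟨n, hn⟩ : ∃ n : ℕ, √3 / 16 ≤ 2 ^ n * d := by
    obtain ⟨n, hn⟩ := pow_unbounded_of_one_lt (√3 / 16 / d) one_lt_two
    exact ⟨n, ((div_lt_iff₀ hd).1 hn).le⟩
  induction n generalizing x d with
  | zero => exact hS.mul_muS_closedBall_le_of_base hm hx (by simpa using hn) hd'
  | succ n ih =>
    rcases le_or_gt (√3 / 16) d with h | h
    · exact hS.mul_muS_closedBall_le_of_base hm hx h hd'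
    obtain ⟨i, y, hy, rfl⟩ := hS.exists_eq_f hx
    obtain ⟨j, hj, hzoom⟩ := hS.exists_junctionZoom_mem i hy h
    refine mul_muS_le_of_le_third hd.le (muS_closedBall_le_junctionZoom i j hzoom)
      (ih hj (by positivity) (by linarith) ?_)
    rw [pow_succ] at hn
    linarith

end IsGasket

/-! ### Centred coverings -/

section Cover

variable {S : Set Plane}

/-- The infimum of the `s`-dimensional size of the coverings of `A` by balls of diameter at most
`δ` centred in `S`. -/
def centredContent (S : Set Plane) (δ : ℝ) (A : Set Plane) : ℝ≥0∞ :=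
  ⨅ (x : ℕ → Plane) (d : ℕ → ℝ) (_ : ∀ n, x n ∈ S)
      (_ : ∀ n, 0 ≤ d n) (_ : ∀ n, 2 * d n ≤ δ) (_ : A ⊆ ⋃ n, closedBall (x n) (d n)),
      ∑' n, ENNReal.ofReal ((2 * d n) ^ sDim)

lemma centredContent_le {δ : ℝ} {A : Set Plane} {x : ℕ → Plane} {d : ℕ → ℝ} (hx : ∀ n, x n ∈ S)
    (hd : ∀ n, 0 ≤ d n) (hδ : ∀ n, 2 * d n ≤ δ) (hA : A ⊆ ⋃ n, closedBall (x n) (d n)) :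
    centredContent S δ A ≤ ∑' n, ENNReal.ofReal ((2 * d n) ^ sDim) :=
  iInf₂_le_of_le x d <| iInf₂_le_of_le hx hd <| iInf₂_le hδ hA

lemma centredPremeasure_eq (S : Set Plane) :
    centredPremeasure sDim S = ⨆ (δ : ℝ) (_ : 0 < δ), centredContent S δ S := rfl

lemma centredContent_mono {δ : ℝ} {A B : Set Plane} (h : A ⊆ B) :
    centredContent S δ A ≤ centredContent S δ B :=
  le_iInf₂ fun _ _ ↦ le_iInf₂ fun hx hd ↦ le_iInf₂ fun hδ hB ↦
    centredContent_le hx hd hδ (h.trans hB)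

lemma centredContent_anti {δ ε : ℝ} (h : δ ≤ ε) (A : Set Plane) :
    centredContent S ε A ≤ centredContent S δ A :=
  le_iInf₂ fun _ _ ↦ le_iInf₂ fun hx hd ↦ le_iInf₂ fun hδ hA ↦
    centredContent_le hx hd (fun n ↦ (hδ n).trans h) hA

lemma centredContent_union_le (δ : ℝ) (A B : Set Plane) :
    centredContent S δ (A ∪ B) ≤ centredContent S δ A + centredContent S δ B := by
  simp only [centredContent.eq_1 S δ A, centredContent.eq_1 S δ B, ENNReal.iInf_add]
  simp only [ENNReal.add_iInf]
  refine le_iInf₂ fun x d ↦ le_iInf₂ fun hx hd ↦ le_iInf₂ fun hδ hA ↦ le_iInf₂ fun x' d' ↦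
    le_iInf₂ fun hx' hd' ↦ le_iInf₂ fun hδ' hB ↦ ?_
  let e := Equiv.natSumNatEquivNat.symm
  refine (centredContent_le (x := Sum.elim x x' ∘ e) (d := Sum.elim d d' ∘ e) ?_ ?_ ?_ ?_).trans_eq
    ?_
  · intro n
    simp only [Function.comp_apply]
    cases e n <;> simp [hx, hx']
  · intro n
    simp only [Function.comp_apply]
    cases e n <;> simp [hd, hd']
  · intro n
    simp only [Function.comp_apply]
    cases e n <;> simp [hδ, hδ']
  · rintro y (hy | hy)
    · obtain ⟨n, hn⟩ := mem_iUnion.1 (hA hy)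
      exact mem_iUnion.2 ⟨e.symm (.inl n), by simpa using hn⟩
    · obtain ⟨n, hn⟩ := mem_iUnion.1 (hB hy)
      exact mem_iUnion.2 ⟨e.symm (.inr n), by simpa using hn⟩
  · simp only [Function.comp_apply]
    rw [e.tsum_eq fun n ↦ ENNReal.ofReal ((2 * Sum.elim d d' n) ^ sDim),
      Summable.tsum_sum ENNReal.summable ENNReal.summable]
    rfl

lemma centredContent_closedBall_le {x : Plane} (hx : x ∈ S) {d δ : ℝ} (hd : 0 ≤ d)
    (hδ : 2 * d ≤ δ) :
    centredContent S δ (closedBall x d) ≤ ENNReal.ofReal ((2 * d) ^ sDim) := by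
  refine (centredContent_le (x := fun _ ↦ x) (d := fun n ↦ if n = 0 then d else 0) (fun _ ↦ hx)
    ?_ ?_ ?_).trans_eq ?_
  · intro n
    split_ifs <;> simp [hd]
  · intro n
    split_ifs <;> linarith
  · exact fun y hy ↦ mem_iUnion.2 ⟨0, by simpa using hy⟩
  · rw [tsum_eq_single 0]
    · simp
    · intro n hn
      simp [hn, Real.zero_rpow sDim_pos.ne']

namespace IsGasket

lemma centredContent_image_f_le (hS : IsGasket S) (i : Fin 3) (δ : ℝ) (A : Set Plane) :
    centredContent S (δ / 2) (f i '' A) ≤ 3⁻¹ * centredContent S δ A := by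
  rw [centredContent.eq_1 S δ A]
  simp only [ENNReal.mul_iInf_of_ne (show (3⁻¹ : ℝ≥0∞) ≠ 0 by simp)
    (show (3⁻¹ : ℝ≥0∞) ≠ ⊤ by simp)]
  refine le_iInf₂ fun x d ↦ le_iInf₂ fun hx hd ↦ le_iInf₂ fun hδ hA ↦ ?_
  refine (centredContent_le (x := fun n ↦ f i (x n)) (d := fun n ↦ d n / 2)
    (fun n ↦ hS.f_mem i (hx n)) (fun n ↦ div_nonneg (hd n) zero_le_two) (fun n ↦ ?_) ?_).trans_eq ?_
  · linarith [hδ n]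
  · rintro _ ⟨y, hy, rfl⟩
    obtain ⟨n, hn⟩ := mem_iUnion.1 (hA hy)
    refine mem_iUnion.2 ⟨n, ?_⟩
    rw [mem_closedBall] at *
    rw [dist_f]
    linarith
  · rw [← ENNReal.tsum_mul_left]
    congr 1 with n
    rw [← ofReal_half_rpow_sDim (by linarith [hd n]), mul_div_assoc]

lemma third_mul_three (a : ℝ≥0∞) : 3⁻¹ * (a + a + a) = a := by
  rw [show a + a + a = 3 * a by ring, ← mul_assoc,
    ENNReal.inv_mul_cancel (by norm_num) (by norm_num), one_mul]

lemma centredContent_half_le (hS : IsGasket S) (δ : ℝ) :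
    centredContent S (δ / 2) S ≤ centredContent S δ S := by
  calc centredContent S (δ / 2) S
      ≤ centredContent S (δ / 2) (f 0 '' S ∪ f 1 '' S ∪ f 2 '' S) :=
        centredContent_mono hS.eq_union.subset
    _ ≤ 3⁻¹ * centredContent S δ S + 3⁻¹ * centredContent S δ S + 3⁻¹ * centredContent S δ S := by
        refine (centredContent_union_le _ _ _).trans (add_le_add ?_
          (hS.centredContent_image_f_le 2 δ S))
        exact (centredContent_union_le _ _ _).trans (add_le_add
          (hS.centredContent_image_f_le 0 δ S) (hS.centredContent_image_f_le 1 δ S))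
    _ = _ := by rw [← mul_add, ← mul_add, third_mul_three]

/-- The gauge `δ` does not influence the centred content of the gasket. -/
lemma centredPremeasure_eq_centredContent (hS : IsGasket S) {δ : ℝ} (hδ : 0 < δ) :
    centredPremeasure sDim S = centredContent S δ S := by
  rw [centredPremeasure_eq]
  refine le_antisymm (iSup₂_le fun ε hε ↦ ?_) (le_iSup₂_of_le δ hδ le_rfl)
  have key (n : ℕ) : centredContent S (δ / 2 ^ n) S ≤ centredContent S δ S := by
    induction n with
    | zero => simp
    | succ n ih =>
      rw [pow_succ, ← div_div]
      exact (hS.centredContent_half_le _).trans ih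
  obtain ⟨n, hn⟩ := pow_unbounded_of_one_lt (δ / ε) one_lt_two
  refine (centredContent_anti ?_ S).trans (key n)
  rw [div_lt_iff₀ hε] at hn
  rw [div_le_iff₀ (by positivity)]
  linarith

lemma centredContent_empty (hS : IsGasket S) {δ : ℝ} (hδ : 0 < δ) :
    centredContent S δ ∅ = 0 := by
  obtain ⟨x, hx⟩ := hS.nonempty
  have := centredContent_closedBall_le hx le_rfl (show 2 * (0 : ℝ) ≤ δ by simpa using hδ.le)
  rw [mul_zero, Real.zero_rpow sDim_pos.ne', ENNReal.ofReal_zero] at this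
  exact le_antisymm ((centredContent_mono (empty_subset _)).trans this) zero_le

/-- The part of the gasket at distance more than `R / 2 ^ n` from `A` has centred content at most
`1 - muS S A` times that of the gasket. -/
lemma centredContent_far_add_le (hS : IsGasket S) {δ R : ℝ} (hδ : 0 < δ)
    (hR : ∀ x ∈ S, ∀ y ∈ S, dist x y ≤ R) (n : ℕ) {A : Set Plane} (hA : MeasurableSet A) :
    centredContent S δ {x ∈ S | ∀ y ∈ A, R / 2 ^ n < dist x y} + muS S A * centredContent S δ S
      ≤ centredContent S δ S := by
  induction n generalizing A with
  | zero =>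
    by_cases h : (A ∩ S).Nonempty
    · obtain ⟨a, haA, haS⟩ := h
      have hempty : {x ∈ S | ∀ y ∈ A, R / 2 ^ 0 < dist x y} = ∅ := by
        rw [eq_empty_iff_forall_notMem]
        rintro x ⟨hx, hxA⟩
        have := hxA a haA
        have := hR x hx a haS
        rw [pow_zero, div_one] at *
        linarith
      have hle : muS S A ≤ 1 := by
        rw [muS_apply S hA]
        exact (mul_le_mul' le_rfl (measure_mono inter_subset_right)).trans
          (ENNReal.inv_mul_le_one _)
      rw [hempty, hS.centredContent_empty hδ, zero_add]
      exact mul_le_of_le_one_left' hle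
    · have hzero : muS S A = 0 := by
        rw [muS_apply S hA, not_nonempty_iff_eq_empty.1 h, measure_empty, mul_zero]
      rw [hzero, zero_mul, add_zero]
      exact centredContent_mono (sep_subset _ _)
  | succ n ih =>
    set N := centredContent S δ S
    let F (B : Set Plane) : Set Plane := {x ∈ S | ∀ y ∈ B, R / 2 ^ n < dist x y}
    have hfar : {x ∈ S | ∀ y ∈ A, R / 2 ^ (n + 1) < dist x y} ⊆
        f 0 '' F (f 0 ⁻¹' A) ∪ f 1 '' F (f 1 ⁻¹' A) ∪ f 2 '' F (f 2 ⁻¹' A) := by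
      rintro x ⟨hxS, hx⟩
      have himage (i : Fin 3) (w : Plane) (hw : w ∈ S) (hwx : f i w = x) :
          x ∈ f i '' F (f i ⁻¹' A) := by
        refine ⟨w, ⟨hw, fun y hy ↦ ?_⟩, hwx⟩
        have := hx (f i y) hy
        rw [← hwx, dist_f, pow_succ, ← div_div] at this
        linarith
      rw [hS.eq_union] at hxS
      rcases hxS with (⟨w, hw, hwx⟩ | ⟨w, hw, hwx⟩) | ⟨w, hw, hwx⟩
      exacts [.inl (.inl (himage _ w hw hwx)), .inl (.inr (himage _ w hw hwx)),
        .inr (himage _ w hw hwx)]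
    have hcell (i : Fin 3) (B : Set Plane) :
        centredContent S δ (f i '' B) ≤ 3⁻¹ * centredContent S δ B := by
      have := hS.centredContent_image_f_le i (2 * δ) B
      rw [mul_div_cancel_left₀ δ two_ne_zero] at this
      exact this.trans (mul_le_mul' le_rfl (centredContent_anti (by linarith) B))
    have hm (i : Fin 3) : MeasurableSet (f i ⁻¹' A) := (continuous_f i).measurable hA
    calc _ ≤ 3⁻¹ * centredContent S δ (F (f 0 ⁻¹' A)) + 3⁻¹ * centredContent S δ (F (f 1 ⁻¹' A))
            + 3⁻¹ * centredContent S δ (F (f 2 ⁻¹' A))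
            + 3⁻¹ * (muS S (f 0 ⁻¹' A) + muS S (f 1 ⁻¹' A) + muS S (f 2 ⁻¹' A)) * N := by
          refine add_le_add ?_ (mul_le_mul' (hS.muS_le_sum_preimage hA) le_rfl)
          refine (centredContent_mono hfar).trans ((centredContent_union_le _ _ _).trans ?_)
          exact add_le_add ((centredContent_union_le _ _ _).trans
            (add_le_add (hcell _ _) (hcell _ _))) (hcell _ _)
      _ = 3⁻¹ * ((centredContent S δ (F (f 0 ⁻¹' A)) + muS S (f 0 ⁻¹' A) * N)
            + (centredContent S δ (F (f 1 ⁻¹' A)) + muS S (f 1 ⁻¹' A) * N)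
            + (centredContent S δ (F (f 2 ⁻¹' A)) + muS S (f 2 ⁻¹' A) * N)) := by ring
      _ ≤ 3⁻¹ * (N + N + N) :=
          mul_le_mul' le_rfl (add_le_add (add_le_add (ih (hm 0)) (ih (hm 1))) (ih (hm 2)))
      _ = N := third_mul_three N

/-- Every ball centred in the gasket bounds the centred premeasure from above. -/
lemma centredPremeasure_mul_muS_closedBall_le (hS : IsGasket S) {x : Plane} (hx : x ∈ S) {d : ℝ}
    (hd : 0 ≤ d) :
    centredPremeasure sDim S * muS S (closedBall x d) ≤ ENNReal.ofReal ((2 * d) ^ sDim) := by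
  obtain ⟨R, hR⟩ : ∃ R, ∀ y ∈ S, ∀ w ∈ S, dist y w ≤ R :=
    Metric.isBounded_iff.1 hS.isCompact.isBounded |>.imp fun R h y hy w hw ↦ h hy hw
  have hR0 : 0 ≤ R := dist_nonneg.trans (hR x hx x hx)
  obtain ⟨δ, hδ0, hδ⟩ : ∃ δ, 0 < δ ∧ 2 * (d + R) ≤ δ :=
    ⟨2 * (d + R) + 1, by positivity, by linarith⟩
  rw [hS.centredPremeasure_eq_centredContent hδ0]
  have hfin : centredContent S δ S ≠ ⊤ := by
    refine ne_top_of_le_ne_top ENNReal.ofReal_ne_top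
      ((centredContent_mono fun y hy ↦ ?_).trans
        (centredContent_closedBall_le (d := d + R) hx (by positivity) hδ))
    exact mem_closedBall.2 ((hR y hy x hx).trans (by linarith))
  have key (n : ℕ) : centredContent S δ S * muS S (closedBall x d) ≤
      ENNReal.ofReal ((2 * (d + R / 2 ^ n)) ^ sDim) := by
    have hfar := hS.centredContent_far_add_le hδ0 hR n (measurableSet_closedBall (x := x) (ε := d))
    set F := {w ∈ S | ∀ y ∈ closedBall x d, R / 2 ^ n < dist w y}
    have hcov : S ⊆ F ∪ closedBall x (d + R / 2 ^ n) := by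
      intro w hw
      by_cases hwF : ∀ y ∈ closedBall x d, R / 2 ^ n < dist w y
      · exact .inl ⟨hw, hwF⟩
      · push Not at hwF
        obtain ⟨y, hy, hwy⟩ := hwF
        rw [mem_closedBall] at hy
        exact .inr (mem_closedBall.2 (by linarith [dist_triangle w y x]))
    have hball := centredContent_closedBall_le (δ := δ) (d := d + R / 2 ^ n) hx (by positivity) (by
      have : R / 2 ^ n ≤ R := div_le_self hR0 (one_le_pow₀ one_le_two)
      linarith)
    have hle := (centredContent_mono (δ := δ) (S := S) hcov).trans (centredContent_union_le _ _ _)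
    have hF : centredContent S δ F ≠ ⊤ :=
      ne_top_of_le_ne_top hfin (centredContent_mono (sep_subset _ _))
    rw [mul_comm]
    exact (ENNReal.add_le_add_iff_left hF).1 (hfar.trans (hle.trans (by gcongr)))
  refine ge_of_tendsto' (x := Filter.atTop) ?_ key
  refine ENNReal.tendsto_ofReal ?_
  have hlim : Filter.Tendsto (fun n : ℕ ↦ R / 2 ^ n) Filter.atTop (nhds 0) :=
    tendsto_const_nhds.div_atTop (tendsto_pow_atTop_atTop_of_one_lt one_lt_two)
  have hcont : Filter.Tendsto (fun n : ℕ ↦ 2 * (d + R / 2 ^ n)) Filter.atTop (nhds (2 * d)) := by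
    simpa using (hlim.const_add d).const_mul 2
  exact hcont.rpow_const (.inr sDim_pos.le)

/-- A lower bound for the ratios of all small balls bounds the centred premeasure from below. -/
lemma le_centredPremeasure (hS0 : μH[sDim] S ≠ 0) (hSt : μH[sDim] S ≠ ⊤)
    {m : ℝ≥0∞} {r : ℝ} (hr : 0 < r)
    (hm : ∀ x ∈ S, ∀ d, 0 < d → d < r →
      m * muS S (closedBall x d) ≤ ENNReal.ofReal ((2 * d) ^ sDim)) :
    m ≤ centredPremeasure sDim S := by
  rw [centredPremeasure_eq]
  refine le_iSup₂_of_le r hr (le_iInf₂ fun x d ↦ le_iInf₂ fun hx hd ↦ le_iInf₂ fun hδ hA ↦ ?_)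
  have hone : 1 ≤ ∑' n, muS S (closedBall (x n) (d n)) := by
    have h1 : (μH[sDim] S)⁻¹ * μH[sDim] S = 1 := ENNReal.inv_mul_cancel hS0 hSt
    simp only [muS_apply S measurableSet_closedBall]
    rw [← h1, ENNReal.tsum_mul_left]
    refine mul_le_mul' le_rfl ((measure_mono fun y hy ↦ ?_).trans (measure_iUnion_le _))
    obtain ⟨n, hn⟩ := mem_iUnion.1 (hA hy)
    exact mem_iUnion.2 ⟨n, hn, hy⟩
  calc m ≤ m * ∑' n, muS S (closedBall (x n) (d n)) := le_mul_of_one_le_right' hone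
    _ = ∑' n, m * muS S (closedBall (x n) (d n)) := ENNReal.tsum_mul_left.symm
    _ ≤ _ := ENNReal.tsum_le_tsum fun n ↦ ?_
  rcases (hd n).eq_or_lt with h0 | h0
  · have := Measure.nullSingletonClass_hausdorff Plane sDim_pos
    rw [muS_apply S measurableSet_closedBall, ← h0, closedBall_zero,
      measure_mono_null inter_subset_left (measure_singleton _)]
    simp
  · exact hm _ (hx n) _ h0 (by linarith [hδ n])

end IsGasket

/-- The density ratio of closed balls is lower semicontinuous in the centre and the radius. -/
lemma lowerSemicontinuousOn_ratio (hS0 : μH[sDim] S ≠ 0) (hSt : μH[sDim] S ≠ ⊤) :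
    LowerSemicontinuousOn
      (fun p : Plane × ℝ ↦ ENNReal.ofReal ((2 * p.2) ^ sDim) / muS S (closedBall p.1 p.2))
      {p | 0 < p.2} := by
  have htop (A : Set Plane) (hA : MeasurableSet A) : muS S A ≠ ⊤ := by
    rw [muS_apply S hA]
    exact ENNReal.mul_ne_top (ENNReal.inv_ne_top.2 hS0)
      (ne_top_of_le_ne_top hSt (measure_mono inter_subset_right))
  rintro ⟨x, d⟩ (hd : 0 < d) a ha
  change a < ENNReal.ofReal ((2 * d) ^ sDim) / muS S (closedBall x d) at ha
  have ha' : a ≠ ⊤ := ha.ne_top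
  rw [ENNReal.lt_div_iff_mul_lt (.inr ha') (.inl (htop _ measurableSet_closedBall))] at ha
  obtain ⟨b, hab, hb⟩ := exists_between ha
  have hthick := tendsto_measure_cthickening_of_isClosed (μ := muS S)
    ⟨1, one_pos, htop _ isClosed_cthickening.measurableSet⟩
    (isClosed_closedBall (x := x) (ε := d))
  have hmul := (ENNReal.Tendsto.const_mul hthick (.inr ha')).eventually_lt_const hab
  obtain ⟨ε, hε0, hε⟩ := Metric.eventually_nhds_iff.1 hmul
  have hrad : ∀ᶠ p : Plane × ℝ in nhds (x, d), b < ENNReal.ofReal ((2 * p.2) ^ sDim) := by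
    have hcont : Continuous fun p : Plane × ℝ ↦ ENNReal.ofReal ((2 * p.2) ^ sDim) :=
      ENNReal.continuous_ofReal.comp
        ((continuous_const.mul continuous_snd).rpow_const fun _ ↦ .inr sDim_pos.le)
    exact hcont.continuousAt.eventually_const_lt hb
  have hnear : ∀ᶠ p : Plane × ℝ in nhds (x, d), dist p.1 x + p.2 < d + ε / 2 := by
    have hcont : Continuous fun p : Plane × ℝ ↦ dist p.1 x + p.2 := by fun_prop
    exact hcont.continuousAt.eventually_lt_const (by simpa using half_pos hε0)
  filter_upwards [nhdsWithin_le_nhds hrad, nhdsWithin_le_nhds hnear] with p hp1 hp2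
  change a < ENNReal.ofReal ((2 * p.2) ^ sDim) / muS S (closedBall p.1 p.2)
  rw [ENNReal.lt_div_iff_mul_lt (.inr ha') (.inl (htop _ measurableSet_closedBall))]
  refine lt_of_le_of_lt ?_ hp1
  have hεb := hε (y := ε / 2) (by simpa [abs_of_pos hε0] using hε0)
  refine (mul_le_mul' le_rfl (measure_mono ?_)).trans hεb.le
  rw [cthickening_closedBall (half_pos hε0).le hd.le]
  exact closedBall_subset_closedBall' (by linarith)

end Cover

theorem statement4 (S : Set (EuclideanSpace ℝ (Fin 2))) (hScomp : IsCompact S) (hSne : S.Nonempty)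
    (hSinv : S = f 0 '' S ∪ f 1 '' S ∪ f 2 '' S)
    (hSpos : 0 < μH[sDim] S) (hSfin : μH[sDim] S < ⊤) :
    ∃ x ∈ fword [0, 1] '' S, ∃ d ∈ Icc (Real.sqrt 3 / 16) (Real.sqrt 3 / 8),
      centredPremeasure sDim S = ENNReal.ofReal ((2 * d) ^ sDim) / muS S (closedBall x d) ∧
      ∀ y ∈ fword [0, 1] '' S, ∀ e ∈ Icc (Real.sqrt 3 / 16) (Real.sqrt 3 / 8),
        centredPremeasure sDim S ≤
          ENNReal.ofReal ((2 * e) ^ sDim) / muS S (closedBall y e) := by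
  have hS : IsGasket S := ⟨hScomp, hSne, hSinv⟩
  have hword (x : Plane) : fword [0, 1] x = f 0 (f 1 x) := rfl
  have hr (d : ℝ) (hd : d ∈ Icc (√3 / 16) (√3 / 8)) : 0 < d :=
    lt_of_lt_of_le (by positivity) hd.1
  have hpos {t : ℝ} (ht : 0 < t) : ENNReal.ofReal ((2 * t) ^ sDim) ≠ 0 := by
    rw [Ne, ENNReal.ofReal_eq_zero, not_le]
    positivity
  have hdiv {c : ℝ≥0∞} {x : Plane} {d : ℝ} (hd : 0 < d) :
      c ≤ ENNReal.ofReal ((2 * d) ^ sDim) / muS S (closedBall x d) ↔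
        c * muS S (closedBall x d) ≤ ENNReal.ofReal ((2 * d) ^ sDim) :=
    ENNReal.le_div_iff_mul_le (.inr (hpos hd)) (.inr ENNReal.ofReal_ne_top)
  have hupper : ∀ y ∈ fword [0, 1] '' S, ∀ e ∈ Icc (√3 / 16) (√3 / 8),
      centredPremeasure sDim S ≤ ENNReal.ofReal ((2 * e) ^ sDim) / muS S (closedBall y e) := by
    rintro _ ⟨y, hy, rfl⟩ e he
    rw [hdiv (hr e he), hword]
    exact hS.centredPremeasure_mul_muS_closedBall_le (hS.f_mem 0 (hS.f_mem 1 hy)) (hr e he).le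
  have hcompact : IsCompact ((fword [0, 1] '' S) ×ˢ Icc (√3 / 16) (√3 / 8)) :=
    (hScomp.image ((continuous_f 0).comp (continuous_f 1))).prod isCompact_Icc
  have hne : ((fword [0, 1] '' S) ×ˢ Icc (√3 / 16) (√3 / 8)).Nonempty :=
    (hSne.image _).prod (nonempty_Icc.2 (by linarith [Real.sqrt_nonneg 3]))
  obtain ⟨⟨x, d⟩, ⟨hx, hd⟩, hmin⟩ := LowerSemicontinuousOn.exists_isMinOn hne hcompact
    ((lowerSemicontinuousOn_ratio hSpos.ne' hSfin.ne).mono fun p hp ↦ hr p.2 hp.2)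
  refine ⟨x, hx, d, hd, le_antisymm (hupper x hx d hd) ?_, hupper⟩
  refine IsGasket.le_centredPremeasure hSpos.ne' hSfin.ne (r := √3 / 8) (by positivity)
    fun y hy e he he' ↦ hS.mul_muS_closedBall_le (fun w hw t ht ↦ ?_) hy he he'
  exact (hdiv (hr t ht)).1 (hmin (show (fword [0, 1] w, t) ∈ _ from ⟨mem_image_of_mem _ hw, ht⟩))

end
end

section
/- Let h : ℝ² → ℝ² be the homothety h(y) := 2y − (1/2, 0) of ratio 2 with fixed point (1/2,0) (the unique point of S₀ ∩ S₁). If x ∈ S₀₁₁ = f₀(f₁(f₁(S))) and 0 < d < √3/16, then h(B(x,d) ∩ S) = B(h(x), 2d) ∩ S, and consequently μ(B(h(x), 2d)) = 2^s · μ(B(x,d)). -/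
open MeasureTheory Metric Set
open scoped ENNReal

noncomputable section

@[simp] lemma pt_zero (a b : ℝ) : pt a b 0 = a := rfl

@[simp] lemma pt_one (a b : ℝ) : pt a b 1 = b := rfl

/-- If the linear functional `α x₀ + β x₁` is at most `c / 2` at each translation vector, then it is
at most `c` on any compact set invariant under the three similitudes. -/
lemma linear_le_of_invariant {S : Set (EuclideanSpace ℝ (Fin 2))} (hS : IsCompact S)
    (hSinv : S = f 0 '' S ∪ f 1 '' S ∪ f 2 '' S) (α β c : ℝ)
    (h : ∀ i, α * v i 0 + β * v i 1 ≤ c / 2) {p : EuclideanSpace ℝ (Fin 2)} (hp : p ∈ S) :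
    α * p 0 + β * p 1 ≤ c := by
  obtain ⟨m, hm, hmax⟩ := hS.exists_isMaxOn ⟨p, hp⟩
    (f := fun p : EuclideanSpace ℝ (Fin 2) => α * p 0 + β * p 1) (by fun_prop)
  have key : ∀ i, ∀ q ∈ S, f i q = m → α * p 0 + β * p 1 ≤ c := by
    intro i q hq hqm
    have h1 := hmax hp
    have h2 := hmax hq
    have h3 := h i
    simp only [mem_ofPred_eq] at h1 h2
    have e (j : Fin 2) : m j = 1 / 2 * q j + v i j := by rw [← hqm]; simp [f]
    rw [e 0, e 1] at h1 h2
    linarith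
  rw [hSinv] at hm
  rcases hm with (⟨q, hq, e⟩ | ⟨q, hq, e⟩) | ⟨q, hq, e⟩
  exacts [key _ q hq e, key _ q hq e, key _ q hq e]

/-- A compact set invariant under the three similitudes lies in the unit triangle. -/
lemma mem_triangle_of_invariant {S : Set (EuclideanSpace ℝ (Fin 2))} (hS : IsCompact S)
    (hSinv : S = f 0 '' S ∪ f 1 '' S ∪ f 2 '' S) {p : EuclideanSpace ℝ (Fin 2)} (hp : p ∈ S) :
    0 ≤ p 0 ∧ 0 ≤ p 1 ∧ p 1 ≤ √3 / 2 ∧ √3 * p 0 + p 1 ≤ √3 := by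
  have h3 : (0 : ℝ) ≤ √3 := Real.sqrt_nonneg 3
  have h1 := linear_le_of_invariant hS hSinv (-1) 0 0
    (by intro i; fin_cases i <;> simp [v]) hp
  have h2 := linear_le_of_invariant hS hSinv 0 (-1) 0
    (by intro i; fin_cases i <;> simp [v]; positivity) hp
  have h4 := linear_le_of_invariant hS hSinv 0 1 (√3 / 2)
    (by intro i; fin_cases i <;> simp [v] <;> linarith) hp
  have h5 := linear_le_of_invariant hS hSinv (√3) 1 (√3)
    (by intro i; fin_cases i <;> simp [v] <;> linarith) hp
  refine ⟨by linarith, by linarith, by linarith, by linarith⟩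

lemma apply_mem_of_invariant {S : Set (EuclideanSpace ℝ (Fin 2))}
    (hSinv : S = f 0 '' S ∪ f 1 '' S ∪ f 2 '' S) (i : Fin 3)
    {p : EuclideanSpace ℝ (Fin 2)} (hp : p ∈ S) : f i p ∈ S := by
  rw [hSinv]
  fin_cases i
  exacts [.inl (.inl ⟨p, hp, rfl⟩), .inl (.inr ⟨p, hp, rfl⟩), .inr ⟨p, hp, rfl⟩]

lemma exists_of_mem_invariant {S : Set (EuclideanSpace ℝ (Fin 2))}
    (hSinv : S = f 0 '' S ∪ f 1 '' S ∪ f 2 '' S) {p : EuclideanSpace ℝ (Fin 2)} (hp : p ∈ S) :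
    ∃ i, ∃ q ∈ S, p = f i q := by
  rw [hSinv] at hp
  rcases hp with (⟨q, hq, e⟩ | ⟨q, hq, e⟩) | ⟨q, hq, e⟩
  exacts [⟨0, q, hq, e.symm⟩, ⟨1, q, hq, e.symm⟩, ⟨2, q, hq, e.symm⟩]

lemma linear_sub_le_dist (α β : ℝ) (x y : EuclideanSpace ℝ (Fin 2)) :
    α * (x 0 - y 0) + β * (x 1 - y 1) ≤ √(α ^ 2 + β ^ 2) * dist x y := by
  rw [EuclideanSpace.dist_eq, ← Real.sqrt_mul (by positivity)]
  apply Real.le_sqrt_of_sq_le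
  simp only [Fin.sum_univ_two, Real.dist_eq, sq_abs]
  nlinarith [sq_nonneg (α * (x 1 - y 1) - β * (x 0 - y 0))]

lemma two_smul_sub_f_zero_f_one (u : EuclideanSpace ℝ (Fin 2)) :
    (2 : ℝ) • f 0 (f 1 u) - pt (1/2) 0 = f 0 u := by
  ext j
  fin_cases j <;> simp [f, v]

lemma two_smul_sub_f_one_f_zero (u : EuclideanSpace ℝ (Fin 2)) :
    (2 : ℝ) • f 1 (f 0 u) - pt (1/2) 0 = f 1 u := by
  ext j
  fin_cases j <;> simp [f, v]
  ring

open scoped Pointwise in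
lemma hausdorffMeasure_two_smul_sub_image {s : ℝ} (hs : 0 ≤ s) (c : EuclideanSpace ℝ (Fin 2))
    (A : Set (EuclideanSpace ℝ (Fin 2))) :
    μH[s] ((fun y => (2 : ℝ) • y - c) '' A) = ENNReal.ofReal ((2 : ℝ) ^ s) * μH[s] A := by
  have e : (fun y => (2 : ℝ) • y - c) '' A = IsometryEquiv.subRight c '' ((2 : ℝ) • A) := by
    rw [← image_smul, image_image]; rfl
  rw [e, IsometryEquiv.hausdorffMeasure_image, Measure.hausdorffMeasure_smul₀ hs two_ne_zero,
    ENNReal.smul_def, smul_eq_mul]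
  congr 1
  rw [ENNReal.ofReal, Real.toNNReal_rpow_of_nonneg zero_le_two]
  simp

lemma dist_two_smul_sub (x y c : EuclideanSpace ℝ (Fin 2)) :
    dist ((2 : ℝ) • x - c) ((2 : ℝ) • y - c) = 2 * dist x y := by
  rw [dist_sub_right, dist_smul₀, Real.norm_ofNat]

theorem statement7 (S : Set (EuclideanSpace ℝ (Fin 2))) (hScomp : IsCompact S) (hSne : S.Nonempty)
    (hSinv : S = f 0 '' S ∪ f 1 '' S ∪ f 2 '' S)
    (hSpos : 0 < μH[sDim] S) (hSfin : μH[sDim] S < ⊤)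
    (x : EuclideanSpace ℝ (Fin 2)) (hx : x ∈ fword [0, 1, 1] '' S)
    (d : ℝ) (hd0 : 0 < d) (hd : d < Real.sqrt 3 / 16) :
    (fun y => (2 : ℝ) • y - pt (1/2) 0) '' (closedBall x d ∩ S)
        = closedBall ((2 : ℝ) • x - pt (1/2) 0) (2 * d) ∩ S ∧
      muS S (closedBall ((2 : ℝ) • x - pt (1/2) 0) (2 * d))
        = ENNReal.ofReal ((2 : ℝ) ^ sDim) * muS S (closedBall x d) := by
  have himage : (fun y => (2 : ℝ) • y - pt (1/2) 0) '' (closedBall x d ∩ S)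
      = closedBall ((2 : ℝ) • x - pt (1/2) 0) (2 * d) ∩ S := by
    obtain ⟨u, hu, rfl⟩ := hx
    obtain ⟨u0, u1, u2, u3⟩ := mem_triangle_of_invariant hScomp hSinv hu
    have h3 : (0 : ℝ) < √3 := by positivity
    have hsq : √3 * √3 = 3 := Real.mul_self_sqrt (by norm_num)
    have hu3 : 0 ≤ √3 * u 0 := by positivity
    have hnorm : √((√3) ^ 2 + 1 ^ 2) = 2 := by
      rw [Real.sqrt_eq_iff_mul_self_eq] <;> nlinarith
    apply Subset.antisymm
    · rintro _ ⟨y, ⟨hyd, hyS⟩, rfl⟩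
      refine ⟨by
        rw [mem_closedBall] at hyd ⊢
        rw [dist_two_smul_sub]; linarith, ?_⟩
      rw [mem_closedBall] at hyd
      have hvert := linear_sub_le_dist 0 1 y (fword [0, 1, 1] u)
      have hslant := linear_sub_le_dist (√3) 1 (fword [0, 1, 1] u) y
      have hhor := linear_sub_le_dist 1 0 y (fword [0, 1, 1] u)
      rw [dist_comm, hnorm] at hslant
      obtain ⟨i, p, hp, rfl⟩ := exists_of_mem_invariant hSinv hyS
      obtain ⟨j, q, hq, rfl⟩ := exists_of_mem_invariant hSinv hp
      obtain ⟨q0, q1, q2, q3⟩ := mem_triangle_of_invariant hScomp hSinv hq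
      have hq3 : 0 ≤ √3 * q 0 := by positivity
      have hu0 : u 0 ≤ 1 := by nlinarith
      have h3lt : √3 < 2 := by nlinarith
      fin_cases i <;> fin_cases j <;> simp [f, v, fword] at hvert hslant hhor hyd
      · exfalso; nlinarith
      · exact (two_smul_sub_f_zero_f_one q).symm.subst (motive := (· ∈ S))
          (apply_mem_of_invariant hSinv 0 hq)
      · exfalso; linarith
      · exact (two_smul_sub_f_one_f_zero q).symm.subst (motive := (· ∈ S))
          (apply_mem_of_invariant hSinv 1 hq)
      all_goals exfalso; linarith
    · rintro w ⟨hwd, hwS⟩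
      have lift : ∀ y ∈ S, (2 : ℝ) • y - pt (1/2) 0 = w →
          w ∈ (fun y => (2 : ℝ) • y - pt (1/2) 0) '' (closedBall (fword [0, 1, 1] u) d ∩ S) := by
        rintro y hy rfl
        rw [mem_closedBall, dist_two_smul_sub] at hwd
        exact ⟨y, ⟨by rw [mem_closedBall]; linarith, hy⟩, rfl⟩
      obtain ⟨i, p, hp, rfl⟩ := exists_of_mem_invariant hSinv hwS
      have hf (i) {p} := apply_mem_of_invariant hSinv i (p := p)
      fin_cases i
      · exact lift _ (hf 0 (hf 1 hp)) (two_smul_sub_f_zero_f_one p)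
      · exact lift _ (hf 1 (hf 0 hp)) (two_smul_sub_f_one_f_zero p)
      · exfalso
        rw [mem_closedBall] at hwd
        have hvert := linear_sub_le_dist 0 1 (f 2 p) ((2 : ℝ) • fword [0, 1, 1] u - pt (1/2) 0)
        obtain ⟨-, p1, -, -⟩ := mem_triangle_of_invariant hScomp hSinv hp
        simp [f, v, fword] at hvert hwd
        linarith
  refine ⟨himage, ?_⟩
  have hs : 0 ≤ sDim := div_nonneg (Real.log_nonneg (by norm_num)) (Real.log_nonneg (by norm_num))
  simp only [muS, Measure.smul_apply, smul_eq_mul,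
    Measure.restrict_apply measurableSet_closedBall]
  rw [← himage, hausdorffMeasure_two_smul_sub_image hs, mul_left_comm]

end
end

section
/- Let A ⊆ S, k ≥ 1, and suppose I := {i ∈ {0,1,2}^k : S_i ∩ A ≠ ∅} is nonempty. Then μ_k(A) ≤ μ(⋃_{i∈I} S_i). -/
open MeasureTheory Metric Set
open scoped ENNReal

noncomputable section

open scoped Pointwise in
/-- The contraction ratio `1/2` scales `sDim`-dimensional Hausdorff measure by `1/3`. -/
lemma hausdorffMeasure_image_f (i : Fin 3) (B : Set (EuclideanSpace ℝ (Fin 2))) :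
    μH[sDim] (f i '' B) = 3⁻¹ * μH[sDim] B := by
  have hs : (0 : ℝ) ≤ sDim := div_nonneg (Real.log_nonneg (by norm_num))
    (Real.log_nonneg (by norm_num))
  have h1 : f i '' B = (fun x => x + v i) '' ((1/2 : ℝ) • B) := by
    rw [← Set.image_smul, Set.image_image]
    rfl
  have h2 : ((1/2 : ℝ)) ^ sDim = 3⁻¹ := by
    rw [one_div, Real.inv_rpow (by norm_num), sDim, Real.rpow_def_of_pos (by norm_num),
      mul_div_cancel₀ _ (Real.log_pos (by norm_num)).ne', Real.exp_log (by norm_num)]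
  have h3 : ‖(1/2 : ℝ)‖₊ ^ sDim = 3⁻¹ := by
    apply NNReal.eq
    rw [NNReal.coe_rpow, coe_nnnorm, Real.norm_of_nonneg (by norm_num), h2]
    simp
  rw [h1, (isometry_add_right (v i)).hausdorffMeasure_image (Or.inl hs),
    Measure.hausdorffMeasure_smul₀ hs (by norm_num), h3, ENNReal.smul_def, smul_eq_mul,
    ENNReal.coe_inv (by norm_num)]
  simp

lemma hausdorffMeasure_image_fword (l : List (Fin 3)) (B : Set (EuclideanSpace ℝ (Fin 2))) :
    μH[sDim] (fword l '' B) = 3⁻¹ ^ l.length * μH[sDim] B := by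
  induction l with
  | nil => simp [fword]
  | cons i l ih =>
    rw [fword, Set.image_comp, hausdorffMeasure_image_f, ih, List.length_cons, pow_succ',
      mul_assoc]

lemma fword_append_singleton (l : List (Fin 3)) (j : Fin 3) (x : EuclideanSpace ℝ (Fin 2)) :
    fword (l ++ [j]) x = fword l (f j x) := by
  induction l with
  | nil => rfl
  | cons i l ih => exact congrArg (f i) ih

lemma f_z (j : Fin 3) : f j (z j) = z j := by
  simp only [f, z]
  module

lemma image_f_subset {S : Set (EuclideanSpace ℝ (Fin 2))}
    (hSinv : S = f 0 '' S ∪ f 1 '' S ∪ f 2 '' S) (j : Fin 3) : f j '' S ⊆ S := by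
  intro x hx
  rw [hSinv]
  fin_cases j
  · exact Or.inl (Or.inl hx)
  · exact Or.inl (Or.inr hx)
  · exact Or.inr hx

lemma image_fword_subset {S : Set (EuclideanSpace ℝ (Fin 2))}
    (hSinv : S = f 0 '' S ∪ f 1 '' S ∪ f 2 '' S) (l : List (Fin 3)) : fword l '' S ⊆ S := by
  induction l with
  | nil => simp [fword]
  | cons i l ih =>
    rw [fword, Set.image_comp]
    exact (Set.image_mono ih).trans (image_f_subset hSinv i)

lemma subset_iUnion_image_fword {S : Set (EuclideanSpace ℝ (Fin 2))}
    (hSinv : S = f 0 '' S ∪ f 1 '' S ∪ f 2 '' S) (k : ℕ) :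
    S ⊆ ⋃ i : Fin k → Fin 3, fword (List.ofFn i) '' S := by
  induction k with
  | zero => simp [fword, Set.iUnion_const]
  | succ k ih =>
    intro x hx
    have hex : ∃ j, x ∈ f j '' S := by
      rw [hSinv] at hx
      rcases hx with (hx | hx) | hx
      exacts [⟨0, hx⟩, ⟨1, hx⟩, ⟨2, hx⟩]
    obtain ⟨j, y, hy, rfl⟩ := hex
    obtain ⟨i, w, hw, rfl⟩ := Set.mem_iUnion.1 (ih hy)
    refine Set.mem_iUnion.2 ⟨Fin.cons j i, w, hw, ?_⟩
    rw [List.ofFn_cons]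
    rfl

/-- The point of `S` closest to `z j` is `z j` itself, as `f j` halves that distance. -/
lemma z_mem {S : Set (EuclideanSpace ℝ (Fin 2))} (hScomp : IsCompact S) (hSne : S.Nonempty)
    (hSinv : S = f 0 '' S ∪ f 1 '' S ∪ f 2 '' S) (j : Fin 3) : z j ∈ S := by
  obtain ⟨x, hx, hmin⟩ := hScomp.exists_isMinOn hSne
    (f := fun y => ‖y - z j‖) (by fun_prop)
  have h := isMinOn_iff.1 hmin _ (image_f_subset hSinv j ⟨x, hx, rfl⟩)
  have heq : f j x - z j = (1/2 : ℝ) • (x - z j) := by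
    simp only [f, z]
    module
  rw [heq, norm_smul, Real.norm_of_nonneg (by norm_num)] at h
  have h0 : ‖x - z j‖ = 0 := le_antisymm (by linarith) (norm_nonneg _)
  rwa [← sub_eq_zero.1 (norm_eq_zero.1 h0)]

/-- Each atom of `muk (n + 1)` is the fixed vertex of exactly one cell of level `n + 1`. -/
lemma muk_succ_apply (n : ℕ) (A : Set (EuclideanSpace ℝ (Fin 2))) :
    muk (n + 1) A = 3⁻¹ ^ (n + 1) * ∑ i : Fin (n + 1) → Fin 3,
      Measure.dirac (fword (List.ofFn i) (z (i (Fin.last n)))) A := by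
  have key (w : Fin n → Fin 3) (j : Fin 3) :
      fword (List.ofFn (Fin.snoc w j : Fin (n + 1) → Fin 3)) (z j) = fword (List.ofFn w) (z j) := by
    rw [List.ofFn_succ', List.concat_eq_append]
    simp [fword_append_singleton, f_z]
  rw [← (Fin.snocEquiv fun _ : Fin (n + 1) => Fin 3).sum_comp, Fintype.sum_prod_type,
    Finset.sum_comm]
  have hsnoc (w : Fin n → Fin 3) (j : Fin 3) :
      Fin.snocEquiv (fun _ : Fin (n + 1) => Fin 3) (j, w) = Fin.snoc w j := rfl
  simp only [hsnoc, Fin.snoc_last, key, Fin.sum_univ_three, muk, Measure.smul_apply,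
    Measure.finsetSum_apply, Measure.add_apply, smul_eq_mul]
  rfl

/-- Distinct cells of the same level need not be disjoint, but subadditivity over the complement
of `I` bounds the measure of a union of cells below by the sum of their measures. -/
lemma card_mul_le_muS {S : Set (EuclideanSpace ℝ (Fin 2))}
    (hSinv : S = f 0 '' S ∪ f 1 '' S ∪ f 2 '' S)
    (hSpos : 0 < μH[sDim] S) (hSfin : μH[sDim] S < ⊤) {k : ℕ} (I : Finset (Fin k → Fin 3)) :
    3⁻¹ ^ k * (I.card : ℝ≥0∞) ≤ muS S (⋃ i ∈ I, fword (List.ofFn i) '' S) := by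
  set T := ⋃ i ∈ I, fword (List.ofFn i) '' S with hT
  set c : ℝ≥0∞ := 3⁻¹ ^ k * μH[sDim] S with hc
  have hctop : c ≠ ⊤ := ENNReal.mul_ne_top (by simp) hSfin.ne
  have hcover : μH[sDim] S ≤ μH[sDim] T + (Iᶜ.card : ℝ≥0∞) * c := by
    have hsub : S ⊆ T ∪ ⋃ i ∈ Iᶜ, fword (List.ofFn i) '' S := by
      intro x hx
      obtain ⟨i, hi⟩ := Set.mem_iUnion.1 (subset_iUnion_image_fword hSinv k hx)
      by_cases h : i ∈ I
      · exact Or.inl (Set.mem_biUnion h hi)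
      · exact Or.inr (Set.mem_biUnion (Finset.mem_compl.2 h) hi)
    refine (measure_mono hsub).trans ((measure_union_le _ _).trans ?_)
    gcongr
    refine (measure_biUnion_finset_le _ _).trans_eq ?_
    simp [hausdorffMeasure_image_fword, hc]
  have htotal : μH[sDim] S = (I.card : ℝ≥0∞) * c + (Iᶜ.card : ℝ≥0∞) * c := by
    rw [← add_mul, ← Nat.cast_add, Finset.card_add_card_compl, hc, ← mul_assoc]
    simp [← mul_pow, ENNReal.mul_inv_cancel]
  have hle : (I.card : ℝ≥0∞) * c ≤ μH[sDim] T := by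
    rw [htotal] at hcover
    exact (ENNReal.add_le_add_iff_right
      (ENNReal.mul_ne_top (ENNReal.natCast_ne_top _) hctop)).1 hcover
  have hTS : T ⊆ S := Set.iUnion₂_subset fun i _ => image_fword_subset hSinv _
  calc 3⁻¹ ^ k * (I.card : ℝ≥0∞)
      = (μH[sDim] S)⁻¹ * μH[sDim] S * (3⁻¹ ^ k * (I.card : ℝ≥0∞)) := by
        rw [ENNReal.inv_mul_cancel hSpos.ne' hSfin.ne, one_mul]
    _ = (μH[sDim] S)⁻¹ * ((I.card : ℝ≥0∞) * c) := by rw [hc]; ring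
    _ ≤ (μH[sDim] S)⁻¹ * μH[sDim] T := by gcongr
    _ = muS S T := by
        rw [muS, Measure.smul_apply, smul_eq_mul, Measure.restrict_eq_self _ hTS]

theorem statement10 (S : Set (EuclideanSpace ℝ (Fin 2))) (hScomp : IsCompact S) (hSne : S.Nonempty)
    (hSinv : S = f 0 '' S ∪ f 1 '' S ∪ f 2 '' S)
    (hSpos : 0 < μH[sDim] S) (hSfin : μH[sDim] S < ⊤)
    (k : ℕ) (hk : 1 ≤ k) (A : Set (EuclideanSpace ℝ (Fin 2))) (hA : A ⊆ S)
    (hI : {i : Fin k → Fin 3 | (fword (List.ofFn i) '' S ∩ A).Nonempty}.Nonempty) :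
    muk k A ≤
      muS S (⋃ i ∈ {i : Fin k → Fin 3 | (fword (List.ofFn i) '' S ∩ A).Nonempty},
        fword (List.ofFn i) '' S) := by
  classical
  obtain ⟨n, rfl⟩ := Nat.exists_eq_add_of_le' hk
  set I := {i : Fin (n + 1) → Fin 3 | (fword (List.ofFn i) '' S ∩ A).Nonempty} with hIdef
  have hcard := card_mul_le_muS hSinv hSpos hSfin I.toFinset
  simp only [Set.mem_toFinset] at hcard
  refine le_trans ?_ hcard
  rw [muk_succ_apply]
  gcongr
  calc ∑ i : Fin (n + 1) → Fin 3, Measure.dirac (fword (List.ofFn i) (z (i (Fin.last n)))) A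
      ≤ ∑ i : Fin (n + 1) → Fin 3, if i ∈ I.toFinset then (1 : ℝ≥0∞) else 0 := by
        refine Finset.sum_le_sum fun i _ => ?_
        rw [Measure.dirac_apply]
        by_cases h : fword (List.ofFn i) (z (i (Fin.last n))) ∈ A
        · have hi : i ∈ I.toFinset := Set.mem_toFinset.2
            ⟨_, ⟨_, z_mem hScomp hSne hSinv _, rfl⟩, h⟩
          rw [Set.indicator_of_mem h, if_pos hi, Pi.one_apply]
        · rw [Set.indicator_of_notMem h]
          exact zero_le
    _ = (I.toFinset.card : ℝ≥0∞) := by simp only [Finset.sum_boole, Finset.filter_univ_mem]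


end
end

section
/- Let k ≥ 1, x ∈ ℝ² and d > 2^{−k}. If S is not contained in B(x,d) and B(x,d) ∩ A_k ≠ ∅, then there exists y_k ∈ A_k such that, setting d_k := |y_k − x|, one has d − 2^{−k} ≤ d_k ≤ d + 2^{−k} and μ(B(x,d)) ≤ μ_k(B(x, d_k)). -/
open MeasureTheory Metric Set
open scoped ENNReal

noncomputable section

lemma f_z_comm (a b : Fin 3) : f a (z b) = f b (z a) := by
  simp only [f, z, smul_smul]
  norm_num
  exact add_comm _ _

lemma f_z_self (a : Fin 3) : f a (z a) = z a := by
  simp only [f, z, smul_smul]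
  norm_num
  exact (two_smul ℝ (v a)).symm

lemma dist_f_s14 (i : Fin 3) (p q : EuclideanSpace ℝ (Fin 2)) :
    dist (f i p) (f i q) = 1 / 2 * dist p q := by
  rw [f, f, dist_add_right, dist_smul₀]
  norm_num

lemma dist_fword (l : List (Fin 3)) (p q : EuclideanSpace ℝ (Fin 2)) :
    dist (fword l p) (fword l q) = (1 / 2) ^ l.length * dist p q := by
  induction l with
  | nil => simp [fword]
  | cons i l ih =>
    simp only [fword, Function.comp_apply, dist_f_s14, ih, List.length_cons]
    ring

lemma dist_z_le_one (i j : Fin 3) : dist (z i) (z j) ≤ 1 := by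
  have h3 : Real.sqrt 3 ^ 2 = 3 := Real.sq_sqrt (by norm_num)
  rw [EuclideanSpace.dist_eq, Real.sqrt_le_iff, Fin.sum_univ_two, Real.dist_eq, Real.dist_eq,
    sq_abs, sq_abs]
  refine ⟨zero_le_one, ?_⟩
  fin_cases i <;> fin_cases j <;> simp [z, v, pt] <;> nlinarith

lemma fword_replicate_z (n : ℕ) (a : Fin 3) : fword (List.replicate n a) (z a) = z a := by
  induction n with
  | zero => rfl
  | succ n ih => simp [List.replicate_succ, fword, ih, f_z_self]

/-- The vertices of the triangles `fword l {z 0, z 1, z 2}` with `l` of length `n` form a connected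
graph: a property which propagates inside each triangle propagates everywhere. -/
lemma fword_z_connected (n : ℕ) (Q : EuclideanSpace ℝ (Fin 2) → Prop)
    (hQ : ∀ l : List (Fin 3), l.length = n → ∀ i j, Q (fword l (z i)) → Q (fword l (z j)))
    {l l' : List (Fin 3)} (hl : l.length = n) (hl' : l'.length = n) (i j : Fin 3)
    (h : Q (fword l (z i))) : Q (fword l' (z j)) := by
  induction n generalizing Q l l' i j with
  | zero =>
    rw [List.length_eq_zero_iff.mp hl'] at *
    rw [List.length_eq_zero_iff.mp hl] at h
    exact hQ [] rfl i j h
  | succ n ih =>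
    obtain ⟨a, l, rfl⟩ := List.exists_cons_of_length_eq_add_one hl
    obtain ⟨b, l', rfl⟩ := List.exists_cons_of_length_eq_add_one hl'
    have hcell (c : Fin 3) : ∀ m : List (Fin 3), m.length = n → ∀ i j,
        Q (f c (fword m (z i))) → Q (f c (fword m (z j))) :=
      fun m hm => hQ (c :: m) (by simp [hm])
    have hab : Q (f a (z b)) := by
      have := ih (fun p => Q (f a p)) (hcell a) (l := l) (by simpa using hl)
        (List.length_replicate (n := n) (a := b)) i b h
      rwa [fword_replicate_z] at this
    rw [f_z_comm] at hab
    refine ih (fun p => Q (f b p)) (hcell b) (List.length_replicate (n := n) (a := a))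
      (by simpa using hl') a j ?_
    rwa [fword_replicate_z]

lemma mem_iterate_Fop {n : ℕ} {A : Set (EuclideanSpace ℝ (Fin 2))}
    {p : EuclideanSpace ℝ (Fin 2)} :
    p ∈ Fop^[n] A ↔ ∃ l : List (Fin 3), l.length = n ∧ ∃ q ∈ A, fword l q = p := by
  induction n generalizing p with
  | zero => simp [List.length_eq_zero_iff, fword]
  | succ n ih =>
    have hF (B : Set (EuclideanSpace ℝ (Fin 2))) : p ∈ Fop B ↔ ∃ i, ∃ q ∈ B, f i q = p := by
      simp [Fop, Fin.exists_fin_succ, or_assoc]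
    rw [Function.iterate_succ_apply', hF]
    constructor
    · rintro ⟨i, q, hq, rfl⟩
      obtain ⟨l, hl, q', hq', rfl⟩ := ih.mp hq
      exact ⟨i :: l, by simp [hl], q', hq', rfl⟩
    · rintro ⟨l, hl, q, hq, rfl⟩
      obtain ⟨i, l, rfl⟩ := List.exists_cons_of_length_eq_add_one hl
      exact ⟨i, fword l q, ih.mpr ⟨l, by simpa using hl, q, hq, rfl⟩, rfl⟩

lemma mem_Aset_succ {n : ℕ} {p : EuclideanSpace ℝ (Fin 2)} :
    p ∈ Aset (n + 1) ↔ ∃ l : List (Fin 3), l.length = n ∧ ∃ j, fword l (z j) = p := by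
  simp [Aset, mem_iterate_Fop, Fin.exists_fin_succ]

lemma finite_Aset (k : ℕ) : (Aset k).Finite := by
  have h (n : ℕ) : (Fop^[n] {z 0, z 1, z 2}).Finite := by
    induction n with
    | zero => simp
    | succ n ih =>
      rw [Function.iterate_succ_apply']
      exact ((ih.image _).union (ih.image _)).union (ih.image _)
  exact h _

lemma exists_fword_eq {S : Set (EuclideanSpace ℝ (Fin 2))} (hS : S = Fop S) (n : ℕ)
    {p : EuclideanSpace ℝ (Fin 2)} (hp : p ∈ S) :
    ∃ l : List (Fin 3), l.length = n ∧ ∃ j, p ∈ fword l '' (f j '' S) := by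
  rw [← Function.iterate_fixed hS.symm n] at hp
  obtain ⟨l, hl, q, hq, rfl⟩ := mem_iterate_Fop.mp hp
  rw [hS] at hq
  rcases hq with (hq | hq) | hq
  exacts [⟨l, hl, 0, q, hq, rfl⟩, ⟨l, hl, 1, q, hq, rfl⟩, ⟨l, hl, 2, q, hq, rfl⟩]

lemma dist_z_le_of_invariant {S : Set (EuclideanSpace ℝ (Fin 2))} (hScomp : IsCompact S)
    (hS : S = Fop S) {p : EuclideanSpace ℝ (Fin 2)} (hp : p ∈ S) (j : Fin 3) :
    dist p (z j) ≤ 1 := by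
  obtain ⟨m, hm, hmax⟩ := hScomp.exists_isMaxOn ⟨p, hp⟩
    (f := fun q => dist q (z j)) (by fun_prop)
  have hm' : ∃ i, ∃ q ∈ S, f i q = m := by
    rw [hS] at hm
    rcases hm with (⟨q, hq, h⟩ | ⟨q, hq, h⟩) | ⟨q, hq, h⟩
    exacts [⟨0, q, hq, h⟩, ⟨1, q, hq, h⟩, ⟨2, q, hq, h⟩]
  obtain ⟨i, q, hq, rfl⟩ := hm'
  have h1 : dist q (z j) ≤ dist (f i q) (z j) := hmax hq
  have h2 : dist p (z j) ≤ dist (f i q) (z j) := hmax hp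
  have h3 : dist (f i q) (z j) ≤ 1 / 2 * dist q (z j) + 1 / 2 * dist (z i) (z j) := by
    calc dist (f i q) (z j) = dist (f i q) (f j (z j)) := by rw [f_z_self]
      _ ≤ dist (f i q) (f i (z j)) + dist (f i (z j)) (f j (z j)) := dist_triangle _ _ _
      _ = _ := by rw [dist_f_s14, f_z_comm i j, dist_f_s14]
  linarith [dist_z_le_one i j]

lemma dist_fword_z_le_of_mem {S : Set (EuclideanSpace ℝ (Fin 2))} (hScomp : IsCompact S)
    (hS : S = Fop S) {l : List (Fin 3)} {j : Fin 3} {p : EuclideanSpace ℝ (Fin 2)}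
    (hp : p ∈ fword l '' (f j '' S)) :
    dist p (fword l (z j)) ≤ (1 / 2) ^ (l.length + 1) := by
  obtain ⟨_, ⟨q, hq, rfl⟩, rfl⟩ := hp
  rw [dist_fword, ← f_z_self j, dist_f_s14, pow_succ]
  gcongr
  linarith [dist_z_le_of_invariant hScomp hS hq j]

lemma half_rpow_sDim : (((1 / 2 : NNReal) : ℝ≥0∞)) ^ sDim = 3⁻¹ := by
  have h2 : Real.log 2 ≠ 0 := (Real.log_pos (by norm_num)).ne'
  have hs : 0 ≤ sDim := div_nonneg (Real.log_nonneg (by norm_num)) (Real.log_nonneg (by norm_num))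
  have h : ((1 / 2 : NNReal)) ^ sDim = 3⁻¹ := by
    rw [← NNReal.coe_inj, NNReal.coe_rpow]
    push_cast
    rw [Real.rpow_def_of_pos (by norm_num), sDim, one_div, Real.log_inv,
      show -Real.log 2 * (Real.log 3 / Real.log 2) = -Real.log 3 by field_simp,
      Real.exp_neg, Real.exp_log (by norm_num)]
  rw [← ENNReal.coe_rpow_of_nonneg _ hs, h, ENNReal.coe_inv (by norm_num)]
  norm_num

lemma hausdorffMeasure_image_f_le (i : Fin 3) (A : Set (EuclideanSpace ℝ (Fin 2))) :
    μH[sDim] (f i '' A) ≤ 3⁻¹ * μH[sDim] A := by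
  have hs : 0 ≤ sDim := div_nonneg (Real.log_nonneg (by norm_num)) (Real.log_nonneg (by norm_num))
  rw [← half_rpow_sDim]
  refine LipschitzWith.hausdorffMeasure_image_le (LipschitzWith.of_dist_le_mul fun p q => ?_) hs A
  rw [dist_f_s14]
  norm_num

lemma hausdorffMeasure_image_fword_le (l : List (Fin 3)) (A : Set (EuclideanSpace ℝ (Fin 2))) :
    μH[sDim] (fword l '' A) ≤ 3⁻¹ ^ l.length * μH[sDim] A := by
  induction l with
  | nil => simp [fword]
  | cons i l ih =>
    rw [fword, image_comp, List.length_cons, pow_succ', mul_assoc]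
    exact (hausdorffMeasure_image_f_le i _).trans (by gcongr)

/-- Covering the gasket by its cells bounds `μ` by `μ_k`, as soon as every cell which meets the
first ball has its vertex in the second one. -/
lemma muS_closedBall_le_muk {S : Set (EuclideanSpace ℝ (Fin 2))} (hS : S = Fop S)
    (hSpos : 0 < μH[sDim] S) (hSfin : μH[sDim] S < ⊤) (n : ℕ) {x : EuclideanSpace ℝ (Fin 2)}
    {d ρ : ℝ} (h : ∀ l : List (Fin 3), l.length = n → ∀ j,
      (closedBall x d ∩ fword l '' (f j '' S)).Nonempty → fword l (z j) ∈ closedBall x ρ) :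
    muS S (closedBall x d) ≤ muk (n + 1) (closedBall x ρ) := by
  have hcover : closedBall x d ∩ S ⊆ ⋃ i : Fin n → Fin 3, ⋃ j : Fin 3,
      closedBall x d ∩ fword (List.ofFn i) '' (f j '' S) := by
    rintro p ⟨hpx, hp⟩
    obtain ⟨l, rfl, j, hj⟩ := exists_fword_eq hS n hp
    simp only [mem_iUnion]
    exact ⟨l.get, j, hpx, by rwa [List.ofFn_get]⟩
  have hcell (i : Fin n → Fin 3) (j : Fin 3) :
      μH[sDim] (closedBall x d ∩ fword (List.ofFn i) '' (f j '' S)) ≤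
        3⁻¹ ^ (n + 1) * Measure.dirac (fword (List.ofFn i) (z j)) (closedBall x ρ) *
          μH[sDim] S := by
    rcases (closedBall x d ∩ fword (List.ofFn i) '' (f j '' S)).eq_empty_or_nonempty with he | hne
    · simp [he]
    · rw [Measure.dirac_apply_of_mem (h _ List.length_ofFn j hne), mul_one]
      calc _ ≤ μH[sDim] (fword (List.ofFn i) '' (f j '' S)) := measure_mono inter_subset_right
        _ ≤ 3⁻¹ ^ n * μH[sDim] (f j '' S) := by
          simpa using hausdorffMeasure_image_fword_le (List.ofFn i) (f j '' S)
        _ ≤ 3⁻¹ ^ n * (3⁻¹ * μH[sDim] S) := by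
          gcongr
          exact hausdorffMeasure_image_f_le j S
        _ = _ := by rw [pow_succ, mul_assoc]
  have hmuk : muk (n + 1) (closedBall x ρ) = ∑ i : Fin n → Fin 3, ∑ j : Fin 3,
      3⁻¹ ^ (n + 1) * Measure.dirac (fword (List.ofFn i) (z j)) (closedBall x ρ) := by
    simp only [muk, Measure.smul_apply, Measure.finsetSum_apply, Measure.add_apply, smul_eq_mul,
      ← Finset.mul_sum, Fin.sum_univ_three]
    rfl
  rw [muS, Measure.smul_apply, smul_eq_mul, Measure.restrict_apply isClosed_closedBall.measurableSet,
    mul_comm, ← div_eq_mul_inv, ENNReal.div_le_iff hSpos.ne' hSfin.ne, hmuk, Finset.sum_mul]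
  refine (measure_mono hcover).trans ((measure_iUnion_fintype_le _ _).trans ?_)
  refine Finset.sum_le_sum fun i _ => (measure_iUnion_fintype_le _ _).trans ?_
  rw [Finset.sum_mul]
  exact Finset.sum_le_sum fun j _ => hcell i j

/-- The vertices of `Aset (n + 1)` cannot jump over an annulus of width `2 ^ (-n)`. -/
lemma exists_mem_Aset_annulus {n : ℕ} {x p q : EuclideanSpace ℝ (Fin 2)} {a b : ℝ}
    (hab : a + (1 / 2) ^ n ≤ b) (hp : p ∈ Aset (n + 1)) (hq : q ∈ Aset (n + 1))
    (hpx : dist p x ≤ b) (hqx : a ≤ dist q x) :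
    ∃ y ∈ Aset (n + 1), a ≤ dist y x ∧ dist y x ≤ b := by
  by_contra! hno
  obtain ⟨l, hl, i, rfl⟩ := mem_Aset_succ.mp hp
  obtain ⟨l', hl', j, rfl⟩ := mem_Aset_succ.mp hq
  refine hqx.not_gt (fword_z_connected n (fun u => dist u x < a) ?_ hl hl' i j ?_)
  · intro m hm i' j' hi'
    by_contra! hj'
    have hb := hno _ (mem_Aset_succ.mpr ⟨m, hm, j', rfl⟩) hj'
    have hedge : dist (fword m (z j')) (fword m (z i')) ≤ (1 / 2) ^ n := by
      rw [dist_fword, hm]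
      exact mul_le_of_le_one_right (by positivity) (dist_z_le_one _ _)
    linarith [dist_triangle (fword m (z j')) (fword m (z i')) x]
  · by_contra! hge
    exact (hno _ hp hge).not_ge hpx

theorem statement14 (S : Set (EuclideanSpace ℝ (Fin 2))) (hScomp : IsCompact S) (hSne : S.Nonempty)
    (hSinv : S = f 0 '' S ∪ f 1 '' S ∪ f 2 '' S)
    (hSpos : 0 < μH[sDim] S) (hSfin : μH[sDim] S < ⊤)
    (k : ℕ) (hk : 1 ≤ k) (x : EuclideanSpace ℝ (Fin 2)) (d : ℝ)
    (hd : (2 : ℝ) ^ (-(k : ℤ)) < d)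
    (hnS : ¬ S ⊆ closedBall x d) (hAk : (closedBall x d ∩ Aset k).Nonempty) :
    ∃ y ∈ Aset k, d - (2 : ℝ) ^ (-(k : ℤ)) ≤ dist y x ∧ dist y x ≤ d + (2 : ℝ) ^ (-(k : ℤ)) ∧
      muS S (closedBall x d) ≤ muk k (closedBall x (dist y x)) := by
  obtain ⟨n, rfl⟩ := Nat.exists_eq_add_of_le' hk
  have hr : (2 : ℝ) ^ (-((n + 1 : ℕ) : ℤ)) = (1 / 2) ^ (n + 1) := by
    rw [zpow_neg, zpow_natCast, one_div, inv_pow]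
  rw [hr]
  obtain ⟨p, hpx, hp⟩ := hAk
  obtain ⟨s, hs, hsx⟩ := not_subset.mp hnS
  obtain ⟨l, hl, j, hsl⟩ := exists_fword_eq hSinv n hs
  have hsq := dist_fword_z_le_of_mem hScomp hSinv hsl
  rw [hl] at hsq
  rw [mem_closedBall] at hpx hsx
  have hr0 : (0 : ℝ) < (1 / 2) ^ (n + 1) := by positivity
  obtain ⟨w, hw, hw1, hw2⟩ := exists_mem_Aset_annulus (x := x) (a := d - (1 / 2) ^ (n + 1))
    (b := d + (1 / 2) ^ (n + 1)) (by rw [pow_succ]; linarith) hp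
    (mem_Aset_succ.mpr ⟨l, hl, j, rfl⟩) (by linarith)
    (by linarith [dist_triangle s (fword l (z j)) x])
  obtain ⟨y, ⟨hy, hyx⟩, hmax⟩ := ((finite_Aset (n + 1)).inter_of_left
    {u | dist u x ≤ d + (1 / 2) ^ (n + 1)}).exists_maximalFor (fun u => dist u x) _ ⟨w, hw, hw2⟩
  have hle {u} (hu : u ∈ Aset (n + 1)) (hux : dist u x ≤ d + (1 / 2) ^ (n + 1)) :
      dist u x ≤ dist y x := (le_total _ _).elim id (hmax ⟨hu, hux⟩)
  refine ⟨y, hy, hw1.trans (hle hw hw2), hyx,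
    muS_closedBall_le_muk hSinv hSpos hSfin n fun m hm i ⟨u, hux, hu⟩ => ?_⟩
  refine hle (mem_Aset_succ.mpr ⟨m, hm, i, rfl⟩) ?_
  have hum := dist_fword_z_le_of_mem hScomp hSinv hu
  rw [hm] at hum
  rw [mem_closedBall] at hux
  linarith [dist_triangle_left (fword m (z i)) x u]

end
end
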